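/- arXiv:1510.05979 — 5 statements merged into one kernel-verified Lean document; each statement's English description precedes it below -/
import Mathlib

section
/- Let 0 < σ < 1 and let y : ℝ → ℝ^d (d ≥ 2) be a 1-periodic function of class C² that defines a regular simple closed curve (i.e., ẏ(s) ≠ 0 for all s, and y is injective on [0,1)). Then for every s ∈ ℝ the principal-value limit lim_{δ→0⁺} ∫_{s+δ}^{1+s−δ} (y(s) − y(r))/‖y(s) − y(r)‖^{2+σ} dr exists (is a well-defined element of ℝ^d). -/
open MeasureTheory Real Filter Topology intervalIntegral

theorem abs_rpow_neg_sub_rpow_neg_le {m x z q : ℝ} (hm : 0 < m) (hx : m ≤ x) (hz : m ≤ z)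
    (hq : 0 ≤ q) : |x ^ (-q) - z ^ (-q)| ≤ q * m ^ (-q - 1) * |x - z| := by
  have hder : ∀ w ∈ Set.Ici m,
      HasDerivWithinAt (fun w : ℝ => w ^ (-q)) (-q * w ^ (-q - 1)) (Set.Ici m) w := fun w hw =>
    (Real.hasDerivAt_rpow_const (Or.inl (hm.trans_le hw).ne')).hasDerivWithinAt
  refine (convex_Ici m).norm_image_sub_le_of_norm_hasDerivWithin_le hder (fun w hw => ?_) hz hx
  have hw0 : 0 < w := hm.trans_le hw
  rw [norm_mul, norm_neg, Real.norm_of_nonneg hq, Real.norm_of_nonneg (by positivity)]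
  exact mul_le_mul_of_nonneg_left
    (Real.rpow_le_rpow_of_nonpos hm hw (by linarith)) hq

section NormedSpace

variable {E : Type*} [NormedAddCommGroup E] [NormedSpace ℝ E]

theorem norm_inv_rpow_smul_add_inv_rpow_smul_le {a b : E} {m M q : ℝ} (hm : 0 < m)
    (ha : m ≤ ‖a‖) (hb : m ≤ ‖b‖) (hbM : ‖b‖ ≤ M) (hq : 0 ≤ q) :
    ‖(‖a‖ ^ q)⁻¹ • a + (‖b‖ ^ q)⁻¹ • b‖ ≤
      (m ^ (-q) + q * m ^ (-q - 1) * M) * ‖a + b‖ := by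
  rw [← Real.rpow_neg (norm_nonneg a), ← Real.rpow_neg (norm_nonneg b)]
  have hsplit : ‖a‖ ^ (-q) • a + ‖b‖ ^ (-q) • b =
      ‖a‖ ^ (-q) • (a + b) + (‖b‖ ^ (-q) - ‖a‖ ^ (-q)) • b := by
    rw [smul_add, sub_smul]; abel
  have hab : |‖b‖ - ‖a‖| ≤ ‖a + b‖ := by
    have := abs_norm_sub_norm_le b (-a)
    rwa [norm_neg, sub_neg_eq_add, add_comm b a] at this
  have h1 : ‖a‖ ^ (-q) ≤ m ^ (-q) := Real.rpow_le_rpow_of_nonpos hm ha (by linarith)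
  have h2 := abs_rpow_neg_sub_rpow_neg_le hm hb ha hq
  calc ‖‖a‖ ^ (-q) • a + ‖b‖ ^ (-q) • b‖
      ≤ ‖a‖ ^ (-q) * ‖a + b‖ + |‖b‖ ^ (-q) - ‖a‖ ^ (-q)| * ‖b‖ := by
        rw [hsplit]
        refine (norm_add_le _ _).trans_eq ?_
        rw [norm_smul, norm_smul, Real.norm_of_nonneg (by positivity), Real.norm_eq_abs]
    _ ≤ m ^ (-q) * ‖a + b‖ + (q * m ^ (-q - 1) * ‖a + b‖) * M := by
        gcongr
        exact h2.trans (by gcongr)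
    _ = _ := by ring

theorem ContDiffAt.isBigO_sub_sub_smul_deriv {y : ℝ → E} {s : ℝ} (hy : ContDiffAt ℝ 2 y s) :
    (fun h : ℝ => y (s + h) - y s - h • deriv y s) =O[𝓝 0] fun h => h ^ 2 := by
  have hd1 : ContDiffAt ℝ 1 (deriv y) s := by
    have := (hy.fderiv_right (m := 1) (by norm_num)).clm_apply
      (contDiffAt_const (c := (1 : ℝ)))
    simpa only [fderiv_apply_one_eq_deriv] using this
  have hdiff : ∀ᶠ x in 𝓝 s, DifferentiableAt ℝ y x :=
    (hy.eventually (by simp)).mono fun x hx => hx.differentiableAt (by simp)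
  obtain ⟨C, hC⟩ := (hd1.differentiableAt one_ne_zero).isBigO_sub.bound
  obtain ⟨ε, hε, hball⟩ := Metric.eventually_nhds_iff.1 (hC.and hdiff)
  refine Asymptotics.IsBigO.of_bound C ?_
  filter_upwards [Metric.ball_mem_nhds (0 : ℝ) hε] with h hh
  have hh' : |h| < ε := by simpa using hh
  have hder : ∀ x ∈ Metric.closedBall s |h|,
      HasDerivWithinAt (fun x => y x - x • deriv y s) (deriv y x - deriv y s)
        (Metric.closedBall s |h|) x := fun x hx => by
    have h1 := (hball (lt_of_le_of_lt hx hh')).2.hasDerivAt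
    have h2 := (hasDerivAt_id x).smul_const (deriv y s)
    rw [one_smul] at h2
    exact (h1.sub h2).hasDerivWithinAt
  have hC0 : 0 ≤ C ∨ h = 0 := by
    by_cases h0 : h = 0
    · exact Or.inr h0
    · left
      have := (hball (y := s + h) (by simpa using hh')).1
      have h3 : 0 < ‖s + h - s‖ := by simpa using h0
      exact nonneg_of_mul_nonneg_left ((norm_nonneg _).trans this) h3
  rcases hC0 with hC0 | rfl
  · have := (convex_closedBall s |h|).norm_image_sub_le_of_norm_hasDerivWithin_le
      (C := C * |h|) hder (fun x hx => ?_) (x := s) (y := s + h) (by simp) (by simp)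
    · have e : y (s + h) - (s + h) • deriv y s - (y s - s • deriv y s) =
          y (s + h) - y s - h • deriv y s := by
        rw [add_smul]; abel
      rw [e, add_sub_cancel_left, Real.norm_eq_abs] at this
      refine this.trans_eq ?_
      rw [norm_pow, Real.norm_eq_abs]; ring
    · refine (hball (lt_of_le_of_lt hx hh')).1.trans ?_
      exact mul_le_mul_of_nonneg_left hx hC0
  · simp

theorem ContDiffAt.isBigO_symm_inv_rpow_smul_sub {y : ℝ → E} {s σ : ℝ} (hσ : 0 ≤ σ)
    (hy : ContDiffAt ℝ 2 y s) (hs : deriv y s ≠ 0) :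
    (fun t : ℝ => (‖y s - y (s + t)‖ ^ (2 + σ))⁻¹ • (y s - y (s + t)) +
        (‖y s - y (s - t)‖ ^ (2 + σ))⁻¹ • (y s - y (s - t)))
      =O[𝓝[>] 0] fun t => t ^ (-σ) := by
  obtain ⟨D, hD⟩ := hy.isBigO_sub_sub_smul_deriv.bound
  set v := deriv y s
  have hv0 : 0 < ‖v‖ := norm_pos_iff.2 hs
  have hsmall : ∀ᶠ h : ℝ in 𝓝 0, D * |h| ≤ ‖v‖ / 2 := by
    have : Tendsto (fun h : ℝ => D * |h|) (𝓝 0) (𝓝 (D * |0|)) :=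
      (continuous_const.mul continuous_abs).tendsto 0
    rw [abs_zero, mul_zero] at this
    exact this.eventually_le_const (by positivity)
  have hneg : Tendsto (fun t : ℝ => -t) (𝓝 0) (𝓝 0) := by
    simpa using (continuous_neg (G := ℝ)).tendsto 0
  have key : ∀ h : ℝ, ‖y (s + h) - y s - h • v‖ ≤ D * ‖h ^ 2‖ → D * |h| ≤ ‖v‖ / 2 →
      ‖v‖ / 2 * |h| ≤ ‖y s - y (s + h)‖ ∧ ‖y s - y (s + h)‖ ≤ 2 * ‖v‖ * |h| := by
    intro h h1 h2
    have h3 : ‖y (s + h) - y s - h • v‖ ≤ ‖v‖ / 2 * |h| := by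
      refine h1.trans ?_
      rw [norm_pow, Real.norm_eq_abs, sq, ← mul_assoc]
      gcongr
    have h4 := abs_le.1 ((abs_norm_sub_norm_le (y (s + h) - y s) (h • v)).trans h3)
    rw [norm_smul, Real.norm_eq_abs] at h4
    rw [norm_sub_rev]
    have := mul_nonneg hv0.le (abs_nonneg h)
    constructor <;> nlinarith
  set c := ‖v‖ / 2
  have hc0 : 0 < c := by positivity
  set q := 2 + σ with hq
  refine Asymptotics.IsBigO.of_bound
    ((c ^ (-q) + q * c ^ (-q - 1) * (2 * ‖v‖)) * (2 * D)) ?_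
  filter_upwards [self_mem_nhdsWithin, nhdsWithin_le_nhds hD,
    nhdsWithin_le_nhds (hneg.eventually hD), nhdsWithin_le_nhds hsmall] with t ht h1 h2 h3
  have ht0 : 0 < t := ht
  have ha := key t h1 h3
  have hb := key (-t) h2 (by rwa [abs_neg])
  rw [abs_neg] at hb
  rw [← sub_eq_add_neg] at hb h2
  rw [abs_of_pos ht0] at ha hb
  have hsum : ‖y s - y (s + t) + (y s - y (s - t))‖ ≤ 2 * D * t ^ 2 := by
    have e : y s - y (s + t) + (y s - y (s - t)) =
        -((y (s + t) - y s - t • v) + (y (s - t) - y s - (-t) • v)) := by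
      rw [neg_smul]; abel
    rw [e, norm_neg]
    refine (norm_add_le _ _).trans ((add_le_add h1 h2).trans_eq ?_)
    simp only [norm_pow, norm_neg, Real.norm_of_nonneg ht0.le]
    ring
  refine (norm_inv_rpow_smul_add_inv_rpow_smul_le (mul_pos hc0 ht0) ha.1 hb.1 hb.2
    (by linarith)).trans ?_
  have hq0 : 0 ≤ q := by linarith
  have e1 : t ^ (-q) * t ^ 2 = t ^ (-σ) := by
    rw [← Real.rpow_natCast, ← Real.rpow_add ht0, hq]; congr 1; push_cast; ring
  have e2 : t ^ (-q - 1) * t = t ^ (-q) := by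
    nth_rewrite 2 [← Real.rpow_one t]
    rw [← Real.rpow_add ht0]; congr 1; ring
  rw [Real.mul_rpow hc0.le ht0.le, Real.mul_rpow hc0.le ht0.le,
    Real.norm_of_nonneg (Real.rpow_nonneg ht0.le _), ← e1]
  refine (mul_le_mul_of_nonneg_left hsum (by positivity)).trans_eq ?_
  rw [← e2]
  ring

theorem exists_tendsto_integral_of_isBigO_rpow_neg {G : ℝ → E} {σ b : ℝ} (hb : 0 < b)
    (hσ : σ < 1) (hG : ContinuousOn G (Set.Ioc 0 b)) (hO : G =O[𝓝[>] 0] fun t => t ^ (-σ)) :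
    ∃ L : E, Tendsto (fun δ => ∫ t in δ..b, G t) (𝓝[>] 0) (𝓝 L) := by
  have hat : IntegrableAtFilter G (𝓝[>] 0) := by
    refine hO.integrableAtFilter
      ⟨Set.Ioc 0 b, Ioc_mem_nhdsGT hb, hG.aestronglyMeasurable measurableSet_Ioc⟩
      ⟨Set.Ioc 0 b, Ioc_mem_nhdsGT hb, ?_⟩
    exact (intervalIntegrable_iff_integrableOn_Ioc_of_le hb.le).1
      (intervalIntegral.intervalIntegrable_rpow' (by linarith))
  obtain ⟨U, hU, hGU⟩ := hat
  obtain ⟨ε, hε, hεU⟩ := mem_nhdsGT_iff_exists_Ioc_subset.1 hU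
  have hε0 : 0 < ε := hε
  have hint : IntegrableOn G (Set.Ioc 0 b) := by
    have h2 : IntegrableOn G (Set.Icc ε b) :=
      (hG.mono fun x hx => ⟨hε0.trans_le hx.1, hx.2⟩).integrableOn_Icc
    refine ((hGU.mono_set hεU).union h2).mono_set fun x hx => ?_
    rcases le_total x ε with h | h
    · exact Or.inl ⟨hx.1, h⟩
    · exact Or.inr ⟨h, hx.2⟩
  have hI : IntegrableOn G (Set.uIcc b 0) := by
    rwa [Set.uIcc_of_ge hb.le, integrableOn_Icc_iff_integrableOn_Ioc]
  have hcont := (intervalIntegral.continuousOn_primitive_interval hI) 0 (Set.right_mem_uIcc)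
  refine ⟨-∫ t in b..0, G t, ?_⟩
  simp_rw [intervalIntegral.integral_symm b]
  refine (hcont.mono_left ?_).neg
  rw [Set.uIcc_of_ge hb.le]
  exact nhdsWithin_le_of_mem (mem_of_superset (Ioc_mem_nhdsGT hb) Set.Ioc_subset_Icc_self)

end NormedSpace

theorem Function.Periodic.apply_ne_of_injOn_Ico {α : Type*} {y : ℝ → α}
    (hper : Function.Periodic y 1) (hinj : Set.InjOn y (Set.Ico (0 : ℝ) 1)) {s r : ℝ}
    (hr : r ∈ Set.Ioo s (s + 1)) : y s ≠ y r := by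
  intro h
  have hfract : ∀ x, y (Int.fract x) = y x := fun x => by
    simpa only [mul_one, Int.self_sub_floor] using hper.sub_int_mul_eq (x := x) ⌊x⌋
  have := hinj ⟨Int.fract_nonneg s, Int.fract_lt_one s⟩ ⟨Int.fract_nonneg r, Int.fract_lt_one r⟩
    (by rw [hfract, hfract, h])
  obtain ⟨z, hz⟩ := Int.fract_eq_fract.1 this.symm
  have h1 : (0 : ℝ) < z := by linarith [hr.1]
  have h2 : (z : ℝ) < 1 := by linarith [hr.2]
  norm_cast at h1 h2
  omega

/-- For a 1-periodic C² regular simple closed curve `y : ℝ → ℝ^d`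
(`d ≥ 2`), and `0 < σ < 1`, the principal-value limit
`lim_{δ→0⁺} ∫_{s+δ}^{1+s−δ} (y(s) − y(r))/‖y(s) − y(r)‖^{2+σ} dr`
exists for every `s ∈ ℝ`. -/
theorem pv_limit_exists (d : ℕ) (hd : 2 ≤ d) (σ : ℝ) (hσ0 : 0 < σ) (hσ1 : σ < 1)
    (y : ℝ → EuclideanSpace ℝ (Fin d))
    (hper : Function.Periodic y 1)
    (hC2 : ContDiff ℝ 2 y)
    (hreg : ∀ s : ℝ, deriv y s ≠ 0)
    (hinj : Set.InjOn y (Set.Ico (0 : ℝ) 1)) :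
    ∀ s : ℝ, ∃ L : EuclideanSpace ℝ (Fin d),
      Tendsto
        (fun δ : ℝ => ∫ r in (s + δ)..(1 + s - δ),
          (‖y s - y r‖ ^ (2 + σ))⁻¹ • (y s - y r))
        (𝓝[>] (0 : ℝ)) (𝓝 L) := by
  intro s
  set F : ℝ → EuclideanSpace ℝ (Fin d) :=
    fun r => (‖y s - y r‖ ^ (2 + σ))⁻¹ • (y s - y r) with hF
  have hcont : ContinuousOn F (Set.Ioo s (s + 1)) := by
    have hy : Continuous fun r => y s - y r := continuous_const.sub hC2.continuous
    have hpow : Continuous fun r => ‖y s - y r‖ ^ (2 + σ) :=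
      hy.norm.rpow_const fun _ => Or.inr (by linarith)
    refine (hpow.continuousOn.inv₀ fun r hr => ?_).smul hy.continuousOn
    exact (Real.rpow_pos_of_pos (norm_pos_iff.2
      (sub_ne_zero.2 (hper.apply_ne_of_injOn_Ico hinj hr))) _).ne'
  have hleft : ContinuousOn (fun t => F (s + t)) (Set.Ioc 0 (1 / 2)) :=
    hcont.comp (by fun_prop) fun t ht => ⟨by linarith [ht.1], by linarith [ht.2]⟩
  have hright : ContinuousOn (fun t => F (s + 1 - t)) (Set.Ioc 0 (1 / 2)) :=
    hcont.comp (by fun_prop) fun t ht => ⟨by linarith [ht.2], by linarith [ht.1]⟩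
  have hO : (fun t => F (s + t) + F (s + 1 - t)) =O[𝓝[>] 0] fun t => t ^ (-σ) := by
    have e : ∀ t, y (s + 1 - t) = y (s - t) := fun t => by
      rw [← hper (s - t)]; congr 1; ring
    simp only [hF, e]
    exact hC2.contDiffAt.isBigO_symm_inv_rpow_smul_sub hσ0.le (hreg s)
  obtain ⟨L, hL⟩ := exists_tendsto_integral_of_isBigO_rpow_neg one_half_pos hσ1
    (hleft.add hright) hO
  refine ⟨L, hL.congr' ?_⟩
  filter_upwards [Ioc_mem_nhdsGT (one_half_pos (α := ℝ))] with δ hδ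
  have hsub : Set.uIcc δ (1 / 2) ⊆ Set.Ioc 0 (1 / 2) := by
    rw [Set.uIcc_of_le hδ.2]
    exact fun t ht => ⟨hδ.1.trans_le ht.1, ht.2⟩
  have hint : ∀ a b, a ∈ Set.Ioo s (s + 1) → b ∈ Set.Ioo s (s + 1) →
      IntervalIntegrable F volume a b := fun a b ha hb =>
    (hcont.mono (Set.ordConnected_Ioo.uIcc_subset ha hb)).intervalIntegrable
  have h1 := hδ.1
  have h2 := hδ.2
  simp only [Pi.add_apply]
  rw [intervalIntegral.integral_add (hleft.mono hsub).intervalIntegrable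
    (hright.mono hsub).intervalIntegrable, intervalIntegral.integral_comp_add_left,
    intervalIntegral.integral_comp_sub_left, show s + 1 - 1 / 2 = s + 1 / 2 by ring,
    intervalIntegral.integral_add_adjacent_intervals, add_comm s 1]
  · exact hint _ _ ⟨by linarith, by linarith⟩ ⟨by linarith, by linarith⟩
  · exact hint _ _ ⟨by linarith, by linarith⟩ ⟨by linarith, by linarith⟩
end

section
/- Let 0 < σ < 1 and let y : ℝ → ℝ^d be a 1-periodic C² function with ẏ(s) ≠ 0 for all s. Fix s ∈ ℝ and ε > 0 small enough that y(s+t) ≠ y(s) for 0 < |t| ≤ ε. Then the function G(t) = ((y(s+t) − y(s))/‖y(s+t) − y(s)‖^{2+σ} − ẏ(s)·t/‖ẏ(s)·t‖^{2+σ}) · |t|^σ is bounded on [−ε, ε] \ {0}. -/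
open MeasureTheory Real Filter Topology intervalIntegral

theorem differentiableAt_inv_norm_rpow_smul {E : Type*} [NormedAddCommGroup E]
    [InnerProductSpace ℝ E] (p : ℝ) {v : E} (hv : v ≠ 0) :
    DifferentiableAt ℝ (fun x : E => (‖x‖ ^ p)⁻¹ • x) v := by
  have hn : DifferentiableAt ℝ (fun x : E => ‖x‖) v := differentiableAt_id.norm ℝ hv
  have hpos : 0 < ‖v‖ := norm_pos_iff.mpr hv
  exact ((hn.rpow_const (Or.inl hpos.ne')).fun_inv (Real.rpow_pos_of_pos hpos p).ne').fun_smul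
    differentiableAt_id

theorem inv_norm_rpow_smul_smul {E : Type*} [NormedAddCommGroup E] [NormedSpace ℝ E]
    (p t : ℝ) (x : E) :
    (‖t • x‖ ^ p)⁻¹ • (t • x) = ((|t| ^ p)⁻¹ * t) • ((‖x‖ ^ p)⁻¹ • x) := by
  rw [norm_smul, Real.norm_eq_abs, Real.mul_rpow (abs_nonneg t) (norm_nonneg x), mul_inv,
    smul_smul, smul_smul]
  congr 1
  ring

/-- The first-order Taylor remainder of a `C²` curve is quadratic. -/
theorem exists_norm_sub_sub_smul_deriv_le {E : Type*} [NormedAddCommGroup E] [NormedSpace ℝ E]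
    {y : ℝ → E} (hy : ContDiff ℝ 2 y) (s : ℝ) :
    ∃ K : ℝ, ∀ᶠ t in 𝓝 (0 : ℝ), ‖y (s + t) - y s - t • deriv y s‖ ≤ K * |t| * |t| := by
  have hd : Differentiable ℝ y := hy.differentiable (by norm_num)
  have hd' : Differentiable ℝ (deriv y) :=
    ((contDiff_succ_iff_deriv (n := 1)).1 (by simpa [one_add_one_eq_two] using hy)).2.2.differentiable
      (by norm_num)
  obtain ⟨K, hK, hb⟩ := (hd' s).isBigO_sub.exists_pos
  obtain ⟨δ, hδ, hball⟩ := Metric.eventually_nhds_iff.1 hb.bound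
  refine ⟨K, Metric.eventually_nhds_iff.2 ⟨δ, hδ, fun t ht => ?_⟩⟩
  rw [Real.dist_eq, sub_zero] at ht
  have hderiv : ∀ x ∈ Set.uIcc s (s + t),
      HasDerivWithinAt (fun x => y x - (x - s) • deriv y s) (deriv y x - deriv y s)
        (Set.uIcc s (s + t)) x := fun x _ => by
    have h := (hd x).hasDerivAt.fun_sub
      ((((hasDerivAt_id x).sub_const s)).smul_const (deriv y s))
    simpa using h.hasDerivWithinAt
  have hbound : ∀ x ∈ Set.uIcc s (s + t), ‖deriv y x - deriv y s‖ ≤ K * |t| := fun x hx => by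
    have hx' : |x - s| ≤ |t| := by simpa using Set.abs_sub_left_of_mem_uIcc hx
    refine (hball (y := x) ?_).trans ?_
    · rw [Real.dist_eq]; exact hx'.trans_lt ht
    · rw [Real.norm_eq_abs]; gcongr
  have h := (convex_uIcc s (s + t)).norm_image_sub_le_of_norm_hasDerivWithin_le hderiv hbound
    Set.left_mem_uIcc Set.right_mem_uIcc
  simpa [sub_right_comm] using h

/-- For a 1-periodic C² function `y : ℝ → ℝ^d` with `ẏ(s) ≠ 0` for all `s`,
a fixed `s` and `ε > 0` such that `y(s+t) ≠ y(s)` for `0 < |t| ≤ ε`, the function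
`G(t) = ((y(s+t) − y(s))/‖y(s+t) − y(s)‖^{2+σ} − ẏ(s)t/‖ẏ(s)t‖^{2+σ})·|t|^σ`
is bounded on `[−ε, ε] \ {0}`. -/
theorem G_bounded (d : ℕ) (σ : ℝ) (hσ0 : 0 < σ) (hσ1 : σ < 1)
    (y : ℝ → EuclideanSpace ℝ (Fin d))
    (hper : Function.Periodic y 1)
    (hC2 : ContDiff ℝ 2 y)
    (hreg : ∀ s : ℝ, deriv y s ≠ 0)
    (s ε : ℝ) (hε : 0 < ε)
    (hsep : ∀ t : ℝ, 0 < |t| → |t| ≤ ε → y (s + t) ≠ y s) :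
    ∃ C : ℝ, ∀ t ∈ Set.Icc (-ε) ε \ ({0} : Set ℝ),
      ‖(|t| ^ σ) •
          ((‖y (s + t) - y s‖ ^ (2 + σ))⁻¹ • (y (s + t) - y s) -
            (‖t • deriv y s‖ ^ (2 + σ))⁻¹ • (t • deriv y s))‖ ≤ C := by
  set v := deriv y s
  let F : EuclideanSpace ℝ (Fin d) → EuclideanSpace ℝ (Fin d) :=
    fun x => (‖x‖ ^ (2 + σ))⁻¹ • x
  change ∃ C : ℝ, ∀ t ∈ Set.Icc (-ε) ε \ ({0} : Set ℝ),
    ‖(|t| ^ σ) • (F (y (s + t) - y s) - F (t • v))‖ ≤ C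
  have hFd : ∀ x, x ≠ 0 → DifferentiableAt ℝ F x := fun x hx =>
    differentiableAt_inv_norm_rpow_smul (2 + σ) hx
  have hv0 : v ≠ 0 := hreg s
  obtain ⟨K, hK⟩ := exists_norm_sub_sub_smul_deriv_le hC2 s
  obtain ⟨L, hL, hFO⟩ := (hFd v hv0).isBigO_sub.exists_pos
  have hslope : Tendsto (fun t : ℝ => t⁻¹ • (y (s + t) - y s)) (𝓝[≠] 0) (𝓝 v) :=
    (hC2.differentiable (by norm_num) s).hasDerivAt.tendsto_slope_zero
  have hnear : ∀ᶠ t in 𝓝[≠] (0 : ℝ),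
      ‖(|t| ^ σ) • (F (y (s + t) - y s) - F (t • v))‖ ≤ L * K := by
    filter_upwards [hslope.eventually hFO.bound, nhdsWithin_le_nhds hK, self_mem_nhdsWithin]
      with t hFt hKt ht
    have ht0 : t ≠ 0 := ht
    have htpos : 0 < |t| := abs_pos.mpr ht0
    set u := t⁻¹ • (y (s + t) - y s) with hu
    have hyu : y (s + t) - y s = t • u := by rw [hu, smul_inv_smul₀ ht0]
    have huv : ‖u - v‖ ≤ K * |t| := by
      rw [hyu, ← smul_sub, norm_smul, Real.norm_eq_abs, mul_comm] at hKt
      exact le_of_mul_le_mul_right hKt htpos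
    have hscale : |t| ^ σ * ((|t| ^ (2 + σ))⁻¹ * |t|) = |t|⁻¹ := by
      rw [Real.rpow_add htpos, Real.rpow_two]
      have := (Real.rpow_pos_of_pos htpos σ).ne'
      field_simp
    have hFs : ∀ x, F (t • x) = ((|t| ^ (2 + σ))⁻¹ * t) • F x :=
      inv_norm_rpow_smul_smul (2 + σ) t
    rw [hyu, hFs, hFs, ← smul_sub, smul_smul, norm_smul, norm_mul, norm_mul, norm_inv,
      Real.norm_of_nonneg (Real.rpow_nonneg (abs_nonneg t) σ),
      Real.norm_of_nonneg (Real.rpow_nonneg (abs_nonneg t) (2 + σ)), Real.norm_eq_abs, hscale]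
    calc |t|⁻¹ * ‖F u - F v‖ ≤ |t|⁻¹ * (L * (K * |t|)) := by
          gcongr
          exact hFt.trans (by gcongr)
      _ = L * K := by field_simp
  obtain ⟨δ, hδ, hball⟩ := Metric.eventually_nhds_iff.1 (eventually_nhdsWithin_iff.1 hnear)
  have hcompact : IsCompact (Set.Icc (-ε) ε ∩ {t : ℝ | δ ≤ |t|}) :=
    isCompact_Icc.inter_right (isClosed_le continuous_const continuous_abs)
  have hcont : ContinuousOn (fun t : ℝ => (|t| ^ σ) • (F (y (s + t) - y s) - F (t • v)))
      (Set.Icc (-ε) ε ∩ {t : ℝ | δ ≤ |t|}) := by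
    rintro t ⟨htε, htδ⟩
    have htpos : 0 < |t| := hδ.trans_le htδ
    have hyt : y (s + t) - y s ≠ 0 := sub_ne_zero.2 (hsep t htpos (abs_le.2 htε))
    have h₁ : ContinuousAt (fun t : ℝ => F (y (s + t) - y s)) t :=
      ContinuousAt.comp (f := fun t : ℝ => y (s + t) - y s) (hFd _ hyt).continuousAt
        (by have := hC2.continuous; fun_prop)
    have h₂ : ContinuousAt (fun t : ℝ => F (t • v)) t :=
      ContinuousAt.comp (f := fun t : ℝ => t • v)
        (hFd _ (smul_ne_zero (abs_pos.1 htpos) hv0)).continuousAt (by fun_prop)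
    exact ((continuous_abs.continuousAt.rpow_const (Or.inr hσ0.le)).smul
      (h₁.sub h₂)).continuousWithinAt
  obtain ⟨M, hM⟩ := hcompact.exists_bound_of_continuousOn hcont
  refine ⟨max (L * K) M, fun t ht => ?_⟩
  rcases lt_or_ge |t| δ with h | h
  · exact (hball (by simpa [Real.dist_eq] using h) ht.2).trans (le_max_left _ _)
  · exact (hM t ⟨ht.1, h⟩).trans (le_max_right _ _)
end

section
/- Let 0 < σ < 1, let v > 0, and let y : ℝ → ℝ^d be a 1-periodic C² function defining a regular simple closed curve. Then for every 1-periodic C² function z : ℝ → ℝ^d, the derivative at ε = 0 of ε ↦ 𝒜^σ(y + εz) equals −∫₀¹ [v² ÿ(s) + lim_{δ→0⁺} ∫_{s+δ}^{1+s−δ} σ(y(s) − y(r))/‖y(s) − y(r)‖^{2+σ} dr] · z(s) ds. -/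
open MeasureTheory Real Filter Topology intervalIntegral
open scoped RealInnerProductSpace

/-- The action functional
`𝒜^σ(y) = ∫₀¹ (v²/2)‖ẏ(s)‖² ds + (1/2)∫₀¹∫₀¹ ‖y(s) − y(r)‖^{−σ} dr ds`. -/
noncomputable def actionA (d : ℕ) (σ v : ℝ) (y : ℝ → EuclideanSpace ℝ (Fin d)) : ℝ :=
  (∫ s in (0 : ℝ)..1, v ^ 2 / 2 * ‖deriv y s‖ ^ 2) +
    1 / 2 * ∫ s in (0 : ℝ)..1, ∫ r in (0 : ℝ)..1, ‖y s - y r‖ ^ (-σ)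

section Geometry

variable {E : Type*} [NormedAddCommGroup E] [InnerProductSpace ℝ E]

theorem ContDiff.deriv_one_of_two {y : ℝ → E} (hc : ContDiff ℝ 2 y) :
    ContDiff ℝ 1 (deriv y) := by
  have : ContDiff ℝ (1 + 1) y := by simpa [one_add_one_eq_two] using hc
  exact (contDiff_succ_iff_deriv.1 this).2.2

theorem Function.Periodic.deriv_one {y : ℝ → E} (hper : Function.Periodic y 1) :
    Function.Periodic (deriv y) 1 := by
  intro x
  have h : (fun t => y (t + 1)) = y := funext hper
  rw [← deriv_comp_add_const, h]

theorem Function.Periodic.apply_fract_add {α : Type*} {y : ℝ → α} (hper : Function.Periodic y 1) (s t : ℝ) :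
    y (Int.fract s + t) = y (s + t) := by
  have h := hper.sub_int_mul_eq (x := s + t) ⌊s⌋
  rw [← h]
  congr 1
  rw [← Int.self_sub_floor]
  ring

theorem Function.Periodic.apply_fract {α : Type*} {y : ℝ → α} (hper : Function.Periodic y 1) (s : ℝ) :
    y (Int.fract s) = y s := by
  simpa using hper.apply_fract_add s 0

/-- A continuous periodic function is bounded. -/
theorem Function.Periodic.exists_norm_le {F : Type*} [NormedAddCommGroup F] {y : ℝ → F}
    (hper : Function.Periodic y 1)
    (hc : Continuous y) : ∃ K, 0 ≤ K ∧ ∀ x, ‖y x‖ ≤ K := by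
  obtain ⟨K, hK⟩ := (isCompact_Icc (a := (0 : ℝ)) (b := 1)).exists_bound_of_continuousOn
    hc.continuousOn
  refine ⟨K, (norm_nonneg _).trans (hK 0 (by simp)), fun x => ?_⟩
  rw [← hper.apply_fract]
  exact hK _ ⟨Int.fract_nonneg x, (Int.fract_lt_one x).le⟩

/-- A `C¹` periodic function is globally Lipschitz. -/
theorem Function.Periodic.exists_norm_sub_le {y : ℝ → E} (hper : Function.Periodic y 1)
    (hc : ContDiff ℝ 1 y) : ∃ K, 0 ≤ K ∧ ∀ a b, ‖y b - y a‖ ≤ K * |b - a| := by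
  obtain ⟨K, hK0, hK⟩ := hper.deriv_one.exists_norm_le (hc.continuous_deriv le_rfl)
  refine ⟨K, hK0, fun a b => ?_⟩
  exact convex_univ.norm_image_sub_le_of_norm_deriv_le
    (fun x _ => (hc.differentiable one_ne_zero) x) (fun x _ => hK x) (Set.mem_univ a)
    (Set.mem_univ b)

/-- The second difference of a `C²` periodic function is quadratically small. -/
theorem Function.Periodic.exists_norm_second_sub_le {y : ℝ → E} (hper : Function.Periodic y 1)
    (hc : ContDiff ℝ 2 y) :
    ∃ M, 0 ≤ M ∧ ∀ s t, 0 ≤ t → ‖(y (s + t) - y s) - (y s - y (s - t))‖ ≤ M * t ^ 2 := by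
  have hc1 : ContDiff ℝ 1 (deriv y) := hc.deriv_one_of_two
  obtain ⟨M, hM0, hM⟩ := hper.deriv_one.exists_norm_sub_le hc1
  refine ⟨M, hM0, fun s t ht => ?_⟩
  have hd : ∀ x, HasDerivAt y (deriv y x) x := fun x =>
    ((hc.differentiable two_ne_zero) x).hasDerivAt
  have hg : ∀ x, HasDerivAt (fun x => y (x + t) - y x) (deriv y (x + t) - deriv y x) x :=
    fun x => ((hd (x + t)).comp_add_const x t).sub (hd x)
  have h := convex_univ.norm_image_sub_le_of_norm_deriv_le (𝕜 := ℝ)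
    (f := fun x => y (x + t) - y x) (C := M * t)
    (fun x _ => (hg x).differentiableAt)
    (fun x _ => by
      rw [(hg x).deriv]
      refine (hM x (x + t)).trans (le_of_eq ?_)
      rw [add_sub_cancel_left, abs_of_nonneg ht]) (Set.mem_univ (s - t))
    (Set.mem_univ s)
  simp only [sub_add_cancel, sub_sub_cancel, Real.norm_eq_abs, abs_of_nonneg ht] at h
  linarith [sq t]

theorem Function.Periodic.apply_add_ne {α : Type*} {y : ℝ → α} (hper : Function.Periodic y 1)
    (hinj : Set.InjOn y (Set.Ico (0 : ℝ) 1)) {s t : ℝ} (ht0 : 0 < t) (ht1 : t < 1) :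
    y (s + t) ≠ y s := by
  intro h
  rw [← hper.apply_fract, ← hper.apply_fract s] at h
  have h2 := hinj ⟨Int.fract_nonneg _, Int.fract_lt_one _⟩
    ⟨Int.fract_nonneg _, Int.fract_lt_one _⟩ h
  obtain ⟨n, hn⟩ := Int.fract_eq_fract.1 h2
  rw [add_sub_cancel_left] at hn
  subst hn
  have h0 : (0 : ℤ) < n := by exact_mod_cast ht0
  have h1 : n < (1 : ℤ) := by exact_mod_cast ht1
  omega

/-- Chord-arc lower bound for a regular simple closed curve. -/
theorem Function.Periodic.exists_mul_le_norm_sub [CompleteSpace E] {y : ℝ → E}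
    (hper : Function.Periodic y 1) (hc : ContDiff ℝ 1 y) (hreg : ∀ s : ℝ, deriv y s ≠ 0)
    (hinj : Set.InjOn y (Set.Ico (0 : ℝ) 1)) :
    ∃ c, 0 < c ∧ ∀ s t, 0 < t → t ≤ 1 / 2 → c * t ≤ ‖y (s + t) - y s‖ := by
  have hd : ∀ x, HasDerivAt y (deriv y x) x := fun x =>
    ((hc.differentiable one_ne_zero) x).hasDerivAt
  have hdc : Continuous (deriv y) := hc.continuous_deriv le_rfl
  have hΦc : Continuous (fun p : ℝ × ℝ => ∫ u in (0 : ℝ)..1, deriv y (p.1 + p.2 * u)) := by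
    refine intervalIntegral.continuous_parametric_intervalIntegral_of_continuous' ?_ 0 1
    exact hdc.comp (by fun_prop)
  have hΦ : ∀ s t : ℝ, t • ∫ u in (0 : ℝ)..1, deriv y (s + t * u) = y (s + t) - y s := by
    intro s t
    rw [intervalIntegral.smul_integral_comp_add_mul (deriv y) t s,
      intervalIntegral.integral_eq_sub_of_hasDerivAt (fun x _ => hd x)
        (hdc.intervalIntegrable _ _)]
    simp
  obtain ⟨p, hp, hmin⟩ := ((isCompact_Icc (a := (0 : ℝ)) (b := 1)).prod
    (isCompact_Icc (a := (0 : ℝ)) (b := 1 / 2))).exists_isMinOn ⟨(0, 0), by simp⟩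
    hΦc.norm.continuousOn
  refine ⟨_, (norm_pos_iff (a := ∫ u in (0 : ℝ)..1, deriv y (p.1 + p.2 * u))).2 ?_, ?_⟩
  · intro h0
    rcases hp.2.1.eq_or_lt with h | h
    · rw [← h] at h0
      simp [hreg] at h0
    · have h1 := hΦ p.1 p.2
      rw [h0, smul_zero] at h1
      exact hper.apply_add_ne hinj h (by linarith [hp.2.2]) (sub_eq_zero.1 h1.symm)
  · intro s t ht0 ht1
    rw [← hper.apply_fract_add, ← hper.apply_fract s, ← hΦ, norm_smul, Real.norm_eq_abs,
      abs_of_pos ht0, mul_comm]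
    exact mul_le_mul_of_nonneg_left
      (hmin (a := (Int.fract s, t))
        ⟨⟨Int.fract_nonneg s, (Int.fract_lt_one s).le⟩, ht0.le, ht1⟩) ht0.le

end Geometry

section Force

variable {E : Type*} [NormedAddCommGroup E] [InnerProductSpace ℝ E]

/-- The force `σ a / ‖a‖ ^ (2 + σ)` attached to the potential `‖a‖ ^ (-σ)`. -/
noncomputable def rieszForce (σ : ℝ) (a : E) : E := (σ / ‖a‖ ^ (2 + σ)) • a

theorem rieszForce_neg (σ : ℝ) (a : E) : rieszForce σ (-a) = -rieszForce σ a := by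
  simp [rieszForce]

theorem continuousOn_rieszForce {σ : ℝ} : ContinuousOn (rieszForce (E := E) σ) {0}ᶜ := by
  intro a ha
  have ha : ‖a‖ ≠ 0 := norm_ne_zero_iff.2 ha
  refine ContinuousAt.continuousWithinAt ?_
  unfold rieszForce
  refine ContinuousAt.smul (continuousAt_const.div ?_ ?_) continuousAt_id
  · exact continuous_norm.continuousAt.rpow_const (Or.inl ha)
  · exact (Real.rpow_pos_of_pos ((norm_nonneg a).lt_of_ne' ha) _).ne'

theorem continuous_rieszForce_comp {σ : ℝ} {X : Type*} [TopologicalSpace X] {f : X → E}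
    (hf : Continuous f) (h0 : ∀ x, f x ≠ 0) : Continuous (fun x => rieszForce σ (f x)) :=
  continuousOn_rieszForce.comp_continuous hf h0

theorem measurable_rieszForce [MeasurableSpace E] [BorelSpace E] [SecondCountableTopology E]
    (σ : ℝ) : Measurable (rieszForce (E := E) σ) := by
  unfold rieszForce
  fun_prop

theorem norm_rieszForce {σ : ℝ} (hσ : 0 < σ) {a : E} (ha : a ≠ 0) :
    ‖rieszForce σ a‖ = σ * ‖a‖ ^ (-(1 + σ)) := by
  have h : 0 < ‖a‖ := norm_pos_iff.2 ha
  rw [rieszForce, norm_smul, Real.norm_eq_abs, abs_of_pos (by positivity),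
    show -(1 + σ) = -(2 + σ) + 1 by ring, Real.rpow_add_one h.ne', Real.rpow_neg h.le]
  ring

theorem hasDerivAt_norm_rpow_neg (σ : ℝ) {a b : E} {ε : ℝ} (h : a + ε • b ≠ 0) :
    HasDerivAt (fun ε : ℝ => ‖a + ε • b‖ ^ (-σ)) (-⟪rieszForce σ (a + ε • b), b⟫) ε := by
  have hpos : 0 < ‖a + ε • b‖ := norm_pos_iff.2 h
  have h1 : HasDerivAt (fun ε : ℝ => a + ε • b) b ε := by
    simpa using ((hasDerivAt_id ε).smul_const b).const_add a
  have h2 := h1.norm_sq.rpow_const (p := -σ / 2) (Or.inl (by positivity))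
  have h3 : ∀ (x q : ℝ), 0 ≤ x → (x ^ 2) ^ q = x ^ (2 * q) := fun x q hx => by
    rw [← Real.rpow_natCast x 2, ← Real.rpow_mul hx]; norm_num
  simp only [h3 _ _ (norm_nonneg _)] at h2
  convert h2 using 1
  · ext; congr 1; ring
  · rw [rieszForce, real_inner_smul_left, show 2 * (-σ / 2 - 1) = -(2 + σ) by ring,
      Real.rpow_neg hpos.le]
    ring

/-- Local Lipschitz estimate for the force away from the origin. -/
theorem norm_rieszForce_sub_le {σ m R : ℝ} (hσ : 0 < σ) (hm : 0 < m) {a b : E}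
    (ha : m ≤ ‖a‖) (hb : m ≤ ‖b‖) (hbR : ‖b‖ ≤ R) :
    ‖rieszForce σ a - rieszForce σ b‖ ≤
      σ * (m ^ (-(2 + σ)) + (2 + σ) * m ^ (-(2 + σ) - 1) * R) * ‖a - b‖ := by
  set p := 2 + σ with hp
  have hp0 : 0 < p := by linarith
  have hmono : ∀ {x q : ℝ}, m ≤ x → q ≤ 0 → x ^ q ≤ m ^ q := fun hx hq =>
    Real.rpow_le_rpow_of_nonpos hm hx hq
  have hmvt : |‖a‖ ^ (-p) - ‖b‖ ^ (-p)| ≤ p * m ^ (-p - 1) * |‖a‖ - ‖b‖| := by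
    have h := (convex_Ici m).norm_image_sub_le_of_norm_deriv_le (𝕜 := ℝ)
      (f := fun x : ℝ => x ^ (-p)) (C := p * m ^ (-p - 1)) (x := ‖b‖) (y := ‖a‖)
      (fun x hx => Real.differentiableAt_rpow_const_of_ne _ (hm.trans_le hx).ne')
      (fun x hx => by
        have hx0 : 0 < x := hm.trans_le hx
        rw [Real.deriv_rpow_const, norm_mul, norm_neg, Real.norm_eq_abs, Real.norm_eq_abs,
          abs_of_pos hp0, abs_of_pos (Real.rpow_pos_of_pos hx0 _)]
        exact mul_le_mul_of_nonneg_left (hmono hx (by linarith)) hp0.le) hb ha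
    simpa [Real.norm_eq_abs] using h
  have hdiv : ∀ x : E, rieszForce σ x = σ • (‖x‖ ^ (-p) • x) := fun x => by
    rw [rieszForce, smul_smul, Real.rpow_neg (norm_nonneg x), div_eq_mul_inv]
  have hsplit : rieszForce σ a - rieszForce σ b =
      σ • (‖a‖ ^ (-p) • (a - b) + (‖a‖ ^ (-p) - ‖b‖ ^ (-p)) • b) := by
    rw [hdiv, hdiv]; module
  have hR : 0 ≤ R := (norm_nonneg b).trans hbR
  rw [hsplit, norm_smul, Real.norm_eq_abs, abs_of_pos hσ, mul_assoc]
  refine mul_le_mul_of_nonneg_left ?_ hσ.le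
  refine (norm_add_le _ _).trans ?_
  rw [norm_smul, norm_smul, add_mul, Real.norm_eq_abs, Real.norm_eq_abs,
    abs_of_nonneg (Real.rpow_nonneg (norm_nonneg a) _)]
  refine add_le_add (mul_le_mul_of_nonneg_right (hmono ha (by linarith)) (norm_nonneg _)) ?_
  calc |‖a‖ ^ (-p) - ‖b‖ ^ (-p)| * ‖b‖ ≤ (p * m ^ (-p - 1) * ‖a - b‖) * R := by
        gcongr
        exact hmvt.trans (mul_le_mul_of_nonneg_left (abs_norm_sub_norm_le a b) (by positivity))
    _ = p * m ^ (-p - 1) * R * ‖a - b‖ := by ring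

end Force

section Fubini

/-- Lebesgue measure on the strip `(0, 1/2] × (0, 1]`, whose points `(t, s)` parametrize the
chords from parameter `s` to parameter `s + t` of a closed curve. -/
noncomputable abbrev chordMeasure : Measure (ℝ × ℝ) :=
  (volume.restrict (Set.Ioc (0 : ℝ) (1 / 2))).prod (volume.restrict (Set.Ioc (0 : ℝ) 1))

theorem ae_chordMeasure_of_forall {P : ℝ × ℝ → Prop}
    (h : ∀ t s : ℝ, 0 < t → t ≤ 1 / 2 → P (t, s)) : ∀ᵐ p ∂chordMeasure, P p := by
  rw [chordMeasure, Measure.prod_restrict]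
  filter_upwards [ae_restrict_mem (measurableSet_Ioc.prod measurableSet_Ioc)] with p hp
  exact h p.1 p.2 hp.1.1 hp.1.2

theorem integrable_const_mul_rpow_chordMeasure {σ : ℝ} (hσ1 : σ < 1) (B : ℝ) :
    Integrable (fun p : ℝ × ℝ => B * p.1 ^ (-σ)) chordMeasure := by
  have h := (intervalIntegral.intervalIntegrable_rpow' (a := 0) (b := 1 / 2) (r := -σ)
    (by linarith)).const_mul B
  rw [intervalIntegrable_iff_integrableOn_Ioc_of_le (by norm_num)] at h
  exact Integrable.comp_fst (f := fun t : ℝ => B * t ^ (-σ)) h _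

theorem integrable_chordMeasure_of_le {G : Type*} [NormedAddCommGroup G] {σ B : ℝ}
    (hσ1 : σ < 1) {f : ℝ × ℝ → G} (hf : AEStronglyMeasurable f chordMeasure)
    (hB : ∀ t s : ℝ, 0 < t → t ≤ 1 / 2 → ‖f (t, s)‖ ≤ B * t ^ (-σ)) :
    Integrable f chordMeasure :=
  (integrable_const_mul_rpow_chordMeasure hσ1 B).mono' hf
    (ae_chordMeasure_of_forall fun t s h0 h1 => hB t s h0 h1)

theorem intervalIntegrable_of_le_rpow {G : Type*} [NormedAddCommGroup G] {σ B : ℝ}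
    (hσ1 : σ < 1) {f : ℝ → G} (hf : StronglyMeasurable f)
    (hB : ∀ t : ℝ, 0 < t → t ≤ 1 / 2 → ‖f t‖ ≤ B * t ^ (-σ)) :
    IntervalIntegrable f volume 0 (1 / 2) := by
  refine ((intervalIntegral.intervalIntegrable_rpow' (r := -σ)
    (by linarith)).const_mul B).mono_fun' hf.aestronglyMeasurable ?_
  rw [Set.uIoc_of_le (by norm_num)]
  filter_upwards [ae_restrict_mem measurableSet_Ioc] with t ht
  exact hB t ht.1 ht.2

/-- The double integral of a symmetric periodic kernel, as an integral over chords. -/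
theorem integral_integral_eq_chordMeasure {F : ℝ → ℝ → ℝ} (hm : Measurable (Function.uncurry F))
    (hsymm : ∀ s r, F s r = F r s) (hper : ∀ s r, F s (r + 1) = F s r) {σ B : ℝ} (hσ1 : σ < 1)
    (hB : ∀ s t : ℝ, 0 < t → t ≤ 1 / 2 → ‖F s (s + t)‖ ≤ B * t ^ (-σ)) :
    ∫ s in (0 : ℝ)..1, ∫ r in (0 : ℝ)..1, F s r =
      2 * ∫ p, F p.2 (p.2 + p.1) ∂chordMeasure := by
  have hB' : ∀ s t : ℝ, 0 < t → t ≤ 1 / 2 → ‖F s (s - t)‖ ≤ B * t ^ (-σ) := by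
    intro s t h0 h1
    have := hB (s - t) t h0 h1
    rwa [sub_add_cancel, hsymm] at this
  have hmp : Measurable fun p : ℝ × ℝ => F p.2 (p.2 + p.1) :=
    hm.comp (measurable_snd.prodMk (measurable_snd.add measurable_fst))
  have hmn : Measurable fun p : ℝ × ℝ => F p.2 (p.2 - p.1) :=
    hm.comp (measurable_snd.prodMk (measurable_snd.sub measurable_fst))
  have hip := integrable_chordMeasure_of_le hσ1 hmp.aestronglyMeasurable
    (fun t s h0 h1 => hB s t h0 h1)
  have hin := integrable_chordMeasure_of_le hσ1 hmn.aestronglyMeasurable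
    (fun t s h0 h1 => hB' s t h0 h1)
  have hinner : ∀ s, ∫ r in (0 : ℝ)..1, F s r =
      (∫ t in Set.Ioc (0 : ℝ) (1 / 2), F s (s + t)) +
        ∫ t in Set.Ioc (0 : ℝ) (1 / 2), F s (s - t) := by
    intro s
    have hp : IntervalIntegrable (fun t => F s (s + t)) volume 0 (1 / 2) :=
      intervalIntegrable_of_le_rpow hσ1
        (hmp.comp (measurable_id.prodMk measurable_const)).stronglyMeasurable (hB s)
    have hn : IntervalIntegrable (fun t => F s (s - t)) volume 0 (1 / 2) :=
      intervalIntegrable_of_le_rpow hσ1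
        (hmn.comp (measurable_id.prodMk measurable_const)).stronglyMeasurable (hB' s)
    have hn' : IntervalIntegrable (fun t => F s (s + t)) volume (-(1 / 2)) 0 := by
      rw [IntervalIntegrable.iff_comp_neg]
      simpa [sub_eq_add_neg] using hn.symm
    have hshift := Function.Periodic.intervalIntegral_add_eq (f := F s) (T := 1)
      (hper s) 0 (s + -(1 / 2))
    rw [zero_add, show s + -(1 / 2) + 1 = s + 1 / 2 by ring,
      ← intervalIntegral.integral_comp_add_left (F s),
      ← intervalIntegral.integral_add_adjacent_intervals hn' hp,
      ← intervalIntegral.integral_of_le (by norm_num),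
      ← intervalIntegral.integral_of_le (by norm_num)] at *
    rw [hshift, add_comm]
    congr 1
    have := intervalIntegral.integral_comp_neg (a := 0) (b := 1 / 2) (fun t => F s (s + t))
    rw [neg_zero] at this
    rw [← this]
    simp [sub_eq_add_neg]
  have hper2 : ∀ s r, F (s + 1) (r + 1) = F s r := fun s r => by
    rw [hper, hsymm, hper, hsymm]
  simp_rw [hinner]
  rw [intervalIntegral.integral_of_le zero_le_one,
    integral_add hip.integral_prod_right hin.integral_prod_right,
    ← integral_prod_symm _ hip, ← integral_prod_symm _ hin, two_mul]
  congr 1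
  rw [integral_prod _ hip, integral_prod _ hin]
  refine integral_congr_ae (ae_of_all _ fun t => ?_)
  simp only
  rw [← intervalIntegral.integral_of_le zero_le_one,
    ← intervalIntegral.integral_of_le zero_le_one]
  have hφ : Function.Periodic (fun s => F s (s - t)) 1 := fun s => by
    simp only
    rw [show s + 1 - t = s - t + 1 by ring, hper2]
  have h1 := hφ.intervalIntegral_add_eq 0 (0 + t)
  rw [zero_add, show 0 + t + 1 = 1 + t by ring] at h1
  rw [h1, ← intervalIntegral.integral_comp_add_right (fun s => F s (s - t))]
  simp only [add_sub_cancel_right]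
  refine intervalIntegral.integral_congr fun s _ => hsymm _ _

end Fubini

section Potential

variable {E : Type*} [NormedAddCommGroup E] [InnerProductSpace ℝ E]

/-- The principal value of the Riesz force, as an absolutely convergent integral of the
symmetrized force. -/
theorem tendsto_integral_rieszForce [CompleteSpace E] {σ : ℝ} {y : ℝ → E}
    (hper : Function.Periodic y 1) (hc : Continuous y)
    (hinj : Set.InjOn y (Set.Ico (0 : ℝ) 1)) (s : ℝ)
    (hint : IntervalIntegrable
      (fun t => rieszForce σ (y s - y (s - t)) - rieszForce σ (y (s + t) - y s))
      volume 0 (1 / 2)) :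
    Tendsto (fun δ : ℝ => ∫ r in (s + δ)..(1 + s - δ), rieszForce σ (y s - y r))
      (𝓝[>] (0 : ℝ))
      (𝓝 (∫ t in (0 : ℝ)..1 / 2,
        (rieszForce σ (y s - y (s - t)) - rieszForce σ (y (s + t) - y s)))) := by
  have hcont : ContinuousOn (fun r => rieszForce σ (y s - y r)) (Set.Ioo s (s + 1)) := by
    refine continuousOn_rieszForce.comp (by fun_prop) fun r hr => ?_
    have := hper.apply_add_ne hinj (s := s) (t := r - s) (by linarith [hr.1]) (by linarith [hr.2])
    rw [add_sub_cancel] at this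
    exact sub_ne_zero.2 this.symm
  have heq : ∀ δ : ℝ, 0 < δ → δ < 1 / 2 →
      ∫ r in (s + δ)..(1 + s - δ), rieszForce σ (y s - y r) = ∫ t in δ..1 / 2,
        (rieszForce σ (y s - y (s - t)) - rieszForce σ (y (s + t) - y s)) := by
    intro δ h0 h1
    have hi1 : IntervalIntegrable (fun r => rieszForce σ (y s - y r)) volume (s + δ)
        (s + 1 / 2) := by
      refine (hcont.mono fun r hr => ?_).intervalIntegrable
      rw [Set.uIcc_of_le (by linarith)] at hr
      exact ⟨by linarith [hr.1], by linarith [hr.2]⟩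
    have hi2 : IntervalIntegrable (fun r => rieszForce σ (y s - y r)) volume (s + 1 / 2)
        (1 + s - δ) := by
      refine (hcont.mono fun r hr => ?_).intervalIntegrable
      rw [Set.uIcc_of_le (by linarith)] at hr
      exact ⟨by linarith [hr.1], by linarith [hr.2]⟩
    have hc1 : IntervalIntegrable (fun t => rieszForce σ (y s - y (s + t))) volume δ (1 / 2) := by
      refine ContinuousOn.intervalIntegrable (hcont.comp (by fun_prop) fun t ht => ?_)
      rw [Set.uIcc_of_le (by linarith)] at ht
      exact ⟨by linarith [ht.1], by linarith [ht.2]⟩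
    have hc2 : IntervalIntegrable (fun t => rieszForce σ (y s - y (1 + s - t))) volume δ
        (1 / 2) := by
      refine ContinuousOn.intervalIntegrable (hcont.comp (by fun_prop) fun t ht => ?_)
      rw [Set.uIcc_of_le (by linarith)] at ht
      exact ⟨by linarith [ht.2], by linarith [ht.1]⟩
    have e1 := intervalIntegral.integral_comp_add_left (a := δ) (b := 1 / 2)
      (fun r => rieszForce σ (y s - y r)) s
    have e2 := intervalIntegral.integral_comp_sub_left (a := δ) (b := 1 / 2)
      (fun r => rieszForce σ (y s - y r)) (1 + s)
    rw [show 1 + s - 1 / 2 = s + 1 / 2 by ring] at e2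
    rw [← intervalIntegral.integral_add_adjacent_intervals hi1 hi2, ← e1, ← e2, add_comm,
      ← intervalIntegral.integral_add hc2 hc1]
    refine intervalIntegral.integral_congr fun t _ => ?_
    rw [show 1 + s - t = s - t + 1 by ring, hper, sub_eq_add_neg (rieszForce σ _),
      ← rieszForce_neg, neg_sub]
  have hlim := intervalIntegral.continuousOn_primitive_interval_left
    ((intervalIntegrable_iff' (by simp)).1 hint) 0 Set.left_mem_uIcc
  rw [Set.uIcc_of_le (by norm_num)] at hlim
  have hmem : ∀ᶠ δ in 𝓝[>] (0 : ℝ), δ ∈ Set.Ioo (0 : ℝ) (1 / 2) :=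
    Ioo_mem_nhdsGT (by norm_num)
  have hlim2 := hlim.tendsto.mono_left (nhdsWithin_le_of_mem
    (mem_of_superset hmem Set.Ioo_subset_Icc_self))
  refine hlim2.congr' ?_
  filter_upwards [hmem] with δ hδ
  exact (heq δ hδ.1 hδ.2).symm

/-- The symmetrized force has an integrable singularity. -/
theorem exists_norm_rieszForce_sub_le {σ c : ℝ} (hσ : 0 < σ) (hc0 : 0 < c) {y : ℝ → E}
    (hper : Function.Periodic y 1) (hC2 : ContDiff ℝ 2 y)
    (hc : ∀ s t, 0 < t → t ≤ 1 / 2 → c * t ≤ ‖y (s + t) - y s‖) :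
    ∃ C, ∀ s t : ℝ, 0 < t → t ≤ 1 / 2 →
      ‖rieszForce σ (y s - y (s - t)) - rieszForce σ (y (s + t) - y s)‖ ≤ C * t ^ (-σ) := by
  obtain ⟨K, hK0, hK⟩ := hper.exists_norm_sub_le (hC2.of_le one_le_two)
  obtain ⟨M, hM0, hM⟩ := hper.exists_norm_second_sub_le hC2
  refine ⟨σ * (c ^ (-(2 + σ)) + (2 + σ) * c ^ (-(2 + σ) - 1) * K) * M, fun s t h0 h1 => ?_⟩
  have hb := hc s t h0 h1
  have ha : c * t ≤ ‖y s - y (s - t)‖ := by simpa using hc (s - t) t h0 h1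
  have hbR : ‖y (s + t) - y s‖ ≤ K * t := by
    simpa [abs_of_pos h0] using hK s (s + t)
  have h := norm_rieszForce_sub_le hσ (mul_pos hc0 h0) ha hb hbR
  have hd : ‖(y s - y (s - t)) - (y (s + t) - y s)‖ ≤ M * t ^ 2 := by
    rw [norm_sub_rev]; exact hM s t h0.le
  refine h.trans ((mul_le_mul_of_nonneg_left hd (by positivity)).trans (le_of_eq ?_))
  have e1 : (t : ℝ) ^ (-(2 + σ) - 1) * t = t ^ (-(2 + σ)) := by
    rw [← Real.rpow_add_one h0.ne']; congr 1; ring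
  have e2 : (t : ℝ) ^ (-(2 + σ)) * t ^ 2 = t ^ (-σ) := by
    rw [← Real.rpow_natCast t 2, ← Real.rpow_add h0]; congr 1; push_cast; ring
  rw [Real.mul_rpow hc0.le h0.le, Real.mul_rpow hc0.le h0.le, ← e2, ← e1]
  ring

variable [MeasurableSpace E] [BorelSpace E] [SecondCountableTopology E]

/-- Derivative under the integral sign for the interaction energy written over chords. -/
theorem hasDerivAt_integral_chordMeasure {σ c K : ℝ} (hσ0 : 0 < σ) (hσ1 : σ < 1) (hc0 : 0 < c)
    {y z : ℝ → E} (hy : Continuous y) (hz : Continuous z)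
    (hK : ∀ s t, 0 < t → t ≤ 1 / 2 → ‖z (s + t) - z s‖ ≤ K * t) {η : ℝ} (hη0 : 0 < η)
    (hη : ∀ ε ∈ Metric.ball (0 : ℝ) η, ∀ s t, 0 < t → t ≤ 1 / 2 →
      c / 2 * t ≤ ‖(y (s + t) - y s) + ε • (z (s + t) - z s)‖) :
    Integrable (fun p : ℝ × ℝ =>
        ⟪rieszForce σ (y (p.2 + p.1) - y p.2), z (p.2 + p.1) - z p.2⟫) chordMeasure ∧
      HasDerivAt (fun ε : ℝ => ∫ p : ℝ × ℝ,
          ‖(y (p.2 + p.1) - y p.2) + ε • (z (p.2 + p.1) - z p.2)‖ ^ (-σ) ∂chordMeasure)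
        (-∫ p : ℝ × ℝ, ⟪rieszForce σ (y (p.2 + p.1) - y p.2), z (p.2 + p.1) - z p.2⟫
          ∂chordMeasure) 0 := by
  have hw : ∀ ε : ℝ, Measurable fun p : ℝ × ℝ =>
      (y (p.2 + p.1) - y p.2) + ε • (z (p.2 + p.1) - z p.2) := fun ε =>
    Continuous.measurable (by fun_prop)
  have hzm : Measurable fun p : ℝ × ℝ => z (p.2 + p.1) - z p.2 :=
    Continuous.measurable (by fun_prop)
  have hm : ∀ ε : ℝ, Measurable fun p : ℝ × ℝ =>
      ‖(y (p.2 + p.1) - y p.2) + ε • (z (p.2 + p.1) - z p.2)‖ ^ (-σ) := fun ε =>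
    (hw ε).norm.pow_const _
  have hmul : ∀ {t : ℝ}, 0 < t → ∀ q : ℝ, (c / 2 * t) ^ q = (c / 2) ^ q * t ^ q :=
    fun h0 q => Real.mul_rpow (by positivity) h0.le
  have hne : ∀ ε ∈ Metric.ball (0 : ℝ) η, ∀ s t, 0 < t → t ≤ 1 / 2 →
      (y (s + t) - y s) + ε • (z (s + t) - z s) ≠ 0 := fun ε hε s t h0 h1 =>
    norm_pos_iff.1 ((by positivity : 0 < c / 2 * t).trans_le (hη ε hε s t h0 h1))
  have h := hasDerivAt_integral_of_dominated_loc_of_deriv_le (μ := chordMeasure) (𝕜 := ℝ)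
    (F := fun ε p => ‖(y (p.2 + p.1) - y p.2) + ε • (z (p.2 + p.1) - z p.2)‖ ^ (-σ))
    (F' := fun ε p => -⟪rieszForce σ ((y (p.2 + p.1) - y p.2) + ε • (z (p.2 + p.1) - z p.2)),
      z (p.2 + p.1) - z p.2⟫)
    (bound := fun p => σ * (c / 2) ^ (-(1 + σ)) * K * p.1 ^ (-σ)) (x₀ := 0)
    (s := Metric.ball 0 η) (Metric.ball_mem_nhds 0 hη0)
    (Eventually.of_forall fun ε => (hm ε).aestronglyMeasurable)
    (integrable_chordMeasure_of_le (B := (c / 2) ^ (-σ)) hσ1 (hm 0).aestronglyMeasurable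
      fun t s h0 h1 => by
        rw [Real.norm_eq_abs, abs_of_nonneg (Real.rpow_nonneg (norm_nonneg _) _), ← hmul h0]
        exact Real.rpow_le_rpow_of_nonpos (by positivity)
          (hη 0 (Metric.mem_ball_self hη0) s t h0 h1) (by linarith))
    ((((measurable_rieszForce σ).comp (hw 0)).inner hzm).neg.aestronglyMeasurable)
    (ae_chordMeasure_of_forall fun t s h0 h1 ε hε => by
      rw [norm_neg]
      refine (norm_inner_le_norm _ _).trans ?_
      rw [norm_rieszForce hσ0 (hne ε hε s t h0 h1)]
      have e : t ^ (-σ) = t ^ (-(1 + σ)) * t := by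
        rw [← Real.rpow_add_one h0.ne']; congr 1; ring
      have hle := Real.rpow_le_rpow_of_nonpos (by positivity) (hη ε hε s t h0 h1)
        (show -(1 + σ) ≤ 0 by linarith)
      rw [hmul h0] at hle
      calc _ ≤ σ * ((c / 2) ^ (-(1 + σ)) * t ^ (-(1 + σ))) * (K * t) := by
            gcongr
            exact hK s t h0 h1
        _ = σ * (c / 2) ^ (-(1 + σ)) * K * t ^ (-σ) := by rw [e]; ring)
    (integrable_const_mul_rpow_chordMeasure hσ1 _)
    (ae_chordMeasure_of_forall fun t s h0 h1 ε hε =>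
      hasDerivAt_norm_rpow_neg σ (hne ε hε s t h0 h1))
  simp only [zero_smul, add_zero] at h
  rw [MeasureTheory.integral_neg] at h
  exact ⟨by simpa using h.1.neg, h.2⟩

/-- Integration over chords against a difference, rewritten through the symmetrized force. -/
theorem integral_inner_rieszForce_chordMeasure [CompleteSpace E] {σ C : ℝ} (hσ1 : σ < 1)
    {y z : ℝ → E}
    (hper : Function.Periodic y 1) (hzper : Function.Periodic z 1) (hy : Continuous y)
    (hz : Continuous z) (hinj : Set.InjOn y (Set.Ico (0 : ℝ) 1))
    (hC : ∀ s t : ℝ, 0 < t → t ≤ 1 / 2 →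
      ‖rieszForce σ (y s - y (s - t)) - rieszForce σ (y (s + t) - y s)‖ ≤ C * t ^ (-σ))
    (hint : Integrable (fun p : ℝ × ℝ =>
        ⟪rieszForce σ (y (p.2 + p.1) - y p.2), z (p.2 + p.1) - z p.2⟫) chordMeasure) :
    IntervalIntegrable (fun s => ⟪∫ t in (0 : ℝ)..1 / 2,
        (rieszForce σ (y s - y (s - t)) - rieszForce σ (y (s + t) - y s)), z s⟫) volume 0 1 ∧
    ∫ p : ℝ × ℝ, ⟪rieszForce σ (y (p.2 + p.1) - y p.2), z (p.2 + p.1) - z p.2⟫ ∂chordMeasure =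
      ∫ s in (0 : ℝ)..1, ⟪∫ t in (0 : ℝ)..1 / 2,
        (rieszForce σ (y s - y (s - t)) - rieszForce σ (y (s + t) - y s)), z s⟫ := by
  set k : ℝ × ℝ → E := fun p =>
    rieszForce σ (y p.2 - y (p.2 - p.1)) - rieszForce σ (y (p.2 + p.1) - y p.2) with hk
  have hkm : Measurable k :=
    ((measurable_rieszForce σ).comp (Continuous.measurable (by fun_prop))).sub
      ((measurable_rieszForce σ).comp (Continuous.measurable (by fun_prop)))
  have hki : ∀ s, IntegrableOn (fun t => k (t, s)) (Set.Ioc 0 (1 / 2)) := fun s => by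
    rw [← intervalIntegrable_iff_integrableOn_Ioc_of_le (by norm_num)]
    exact intervalIntegrable_of_le_rpow hσ1
      (hkm.comp (measurable_id.prodMk measurable_const)).stronglyMeasurable (hC s)
  obtain ⟨Z, hZ0, hZ⟩ := hzper.exists_norm_le hz
  have hkz : Integrable (fun p : ℝ × ℝ => ⟪k p, z p.2⟫) chordMeasure := by
    refine integrable_chordMeasure_of_le (B := C * Z) hσ1
      (hkm.inner (hz.measurable.comp measurable_snd)).aestronglyMeasurable fun t s h0 h1 => ?_
    refine (norm_inner_le_norm _ _).trans ?_
    refine (mul_le_mul (hC s t h0 h1) (hZ s) (norm_nonneg _)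
      ((norm_nonneg _).trans (hC s t h0 h1))).trans (le_of_eq (by ring))
  have hinner : ∀ s, ∫ t in Set.Ioc (0 : ℝ) (1 / 2), ⟪k (t, s), z s⟫ =
      ⟪∫ t in (0 : ℝ)..1 / 2,
        (rieszForce σ (y s - y (s - t)) - rieszForce σ (y (s + t) - y s)), z s⟫ := fun s => by
    simp_rw [real_inner_comm (z s)]
    rw [integral_inner (hki s), intervalIntegral.integral_of_le (by norm_num)]
  constructor
  · rw [intervalIntegrable_iff_integrableOn_Ioc_of_le zero_le_one]
    simp_rw [← hinner]
    exact hkz.integral_prod_right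
  rw [intervalIntegral.integral_of_le zero_le_one]
  simp_rw [← hinner]
  rw [← integral_prod_symm _ hkz, integral_prod _ hint, integral_prod _ hkz]
  refine setIntegral_congr_fun measurableSet_Ioc fun t ht => ?_
  simp only [hk]
  rw [← intervalIntegral.integral_of_le zero_le_one,
    ← intervalIntegral.integral_of_le zero_le_one]
  have hne : ∀ s, y (s + t) ≠ y s := fun s =>
    hper.apply_add_ne hinj ht.1 (by linarith [ht.2])
  have hc1 : Continuous fun s => rieszForce σ (y (s + t) - y s) :=
    continuous_rieszForce_comp (by fun_prop) fun s => sub_ne_zero.2 (hne s)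
  have hc2 : Continuous fun s => rieszForce σ (y s - y (s - t)) :=
    continuous_rieszForce_comp (by fun_prop) fun s => by
      simpa using sub_ne_zero.2 (hne (s - t))
  have hφ : Function.Periodic (fun s => ⟪rieszForce σ (y s - y (s - t)), z s⟫) 1 := fun s => by
    simp only
    rw [show s + 1 - t = s - t + 1 by ring, hper, hper, hzper]
  have h1 := hφ.intervalIntegral_add_eq 0 (0 + t)
  rw [zero_add, show 0 + t + 1 = 1 + t by ring, ← intervalIntegral.integral_comp_add_right
    (fun s => ⟪rieszForce σ (y s - y (s - t)), z s⟫)] at h1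
  simp only [add_sub_cancel_right] at h1
  simp_rw [inner_sub_right, inner_sub_left]
  rw [intervalIntegral.integral_sub, intervalIntegral.integral_sub, h1]
  all_goals exact Continuous.intervalIntegrable (by fun_prop) _ _

/-- The Gateaux derivative of the interaction energy of a regular simple closed curve. -/
theorem hasDerivAt_interaction [CompleteSpace E] {σ : ℝ} (hσ0 : 0 < σ) (hσ1 : σ < 1)
    {y z L : ℝ → E} (hper : Function.Periodic y 1) (hC2 : ContDiff ℝ 2 y)
    (hreg : ∀ s : ℝ, deriv y s ≠ 0) (hinj : Set.InjOn y (Set.Ico (0 : ℝ) 1))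
    (hL : ∀ s : ℝ, Tendsto
      (fun δ : ℝ => ∫ r in (s + δ)..(1 + s - δ), rieszForce σ (y s - y r))
      (𝓝[>] (0 : ℝ)) (𝓝 (L s)))
    (hzper : Function.Periodic z 1) (hzC2 : ContDiff ℝ 1 z) :
    IntervalIntegrable (fun s => ⟪L s, z s⟫) volume 0 1 ∧
      HasDerivAt (fun ε : ℝ => 1 / 2 * ∫ s in (0 : ℝ)..1, ∫ r in (0 : ℝ)..1,
        ‖(y s + ε • z s) - (y r + ε • z r)‖ ^ (-σ)) (-∫ s in (0 : ℝ)..1, ⟪L s, z s⟫) 0 := by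
  have hy := hC2.continuous
  have hz := hzC2.continuous
  obtain ⟨c, hc0, hc⟩ := hper.exists_mul_le_norm_sub (hC2.of_le one_le_two) hreg hinj
  obtain ⟨K, hK0, hK'⟩ := hzper.exists_norm_sub_le hzC2
  have hK : ∀ s t, 0 < t → t ≤ 1 / 2 → ‖z (s + t) - z s‖ ≤ K * t := fun s t h0 _ => by
    simpa [abs_of_pos h0] using hK' s (s + t)
  obtain ⟨C, hC⟩ := exists_norm_rieszForce_sub_le hσ0 hc0 hper hC2 hc
  have hη0 : 0 < c / (2 * (K + 1)) := by positivity
  have hη : ∀ ε ∈ Metric.ball (0 : ℝ) (c / (2 * (K + 1))), ∀ s t, 0 < t → t ≤ 1 / 2 →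
      c / 2 * t ≤ ‖(y (s + t) - y s) + ε • (z (s + t) - z s)‖ := by
    intro ε hε s t h0 h1
    rw [mem_ball_zero_iff] at hε
    have h2 : ‖ε‖ * K ≤ c / 2 := by
      rw [lt_div_iff₀ (by positivity)] at hε
      nlinarith [norm_nonneg ε]
    have h3 : ‖ε • (z (s + t) - z s)‖ ≤ c / 2 * t := by
      rw [norm_smul]
      calc _ ≤ ‖ε‖ * (K * t) := by gcongr; exact hK s t h0 h1
        _ = ‖ε‖ * K * t := by ring
        _ ≤ c / 2 * t := by gcongr
    have h4 := norm_sub_le_norm_add (y (s + t) - y s) (ε • (z (s + t) - z s))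
    linarith [hc s t h0 h1]
  obtain ⟨hint, hder⟩ := hasDerivAt_integral_chordMeasure hσ0 hσ1 hc0 hy hz hK hη0 hη
  obtain ⟨hLi, heq⟩ := integral_inner_rieszForce_chordMeasure hσ1 hper hzper hy hz hinj hC hint
  have hLeq : ∀ s, L s = ∫ t in (0 : ℝ)..1 / 2,
      (rieszForce σ (y s - y (s - t)) - rieszForce σ (y (s + t) - y s)) := fun s =>
    tendsto_nhds_unique (hL s) (tendsto_integral_rieszForce hper hy hinj s
      (intervalIntegrable_of_le_rpow hσ1 (Measurable.stronglyMeasurable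
        (((measurable_rieszForce σ).comp (Continuous.measurable (by fun_prop))).sub
          ((measurable_rieszForce σ).comp (Continuous.measurable (by fun_prop))))) (hC s)))
  simp_rw [hLeq]
  refine ⟨hLi, ?_⟩
  rw [← heq]
  refine hder.congr_of_eventuallyEq ?_
  filter_upwards [Metric.ball_mem_nhds (0 : ℝ) hη0] with ε hε
  have hdiff : ∀ s t, (y s + ε • z s) - (y t + ε • z t) = (y s - y t) + ε • (z s - z t) :=
    fun s t => by module
  rw [integral_integral_eq_chordMeasure (σ := σ) (B := (c / 2) ^ (-σ))
    (F := fun s r => ‖(y s + ε • z s) - (y r + ε • z r)‖ ^ (-σ))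
    (((Continuous.measurable (by fun_prop)).norm).pow_const _)
    (fun s r => by rw [norm_sub_rev]) (fun s r => by rw [hper, hzper]) hσ1 ?_]
  · rw [← mul_assoc, one_div, inv_mul_cancel₀ two_ne_zero, one_mul]
    refine integral_congr_ae (ae_of_all _ fun p => ?_)
    simp only
    rw [norm_sub_rev, hdiff]
  · intro s t h0 h1
    rw [Real.norm_eq_abs, abs_of_nonneg (Real.rpow_nonneg (norm_nonneg _) _),
      ← Real.mul_rpow (by positivity) h0.le, norm_sub_rev, hdiff]
    exact Real.rpow_le_rpow_of_nonpos (by positivity) (hη ε hε s t h0 h1) (by linarith)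

end Potential

section Kinetic

variable {E : Type*} [NormedAddCommGroup E] [InnerProductSpace ℝ E]

/-- Integration by parts on the circle. -/
theorem integral_inner_deriv_eq_neg {f g : ℝ → E} (hf : Function.Periodic f 1)
    (hg : Function.Periodic g 1) (hfc : ContDiff ℝ 1 f) (hgc : ContDiff ℝ 1 g) :
    ∫ s in (0 : ℝ)..1, ⟪f s, deriv g s⟫ = -∫ s in (0 : ℝ)..1, ⟪deriv f s, g s⟫ := by
  have hf' := hfc.continuous_deriv le_rfl
  have hg' := hgc.continuous_deriv le_rfl
  have hf0 := hfc.continuous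
  have hg0 := hgc.continuous
  have h := intervalIntegral.integral_eq_sub_of_hasDerivAt (a := 0) (b := 1)
    (f := fun s => ⟪f s, g s⟫) (f' := fun s => ⟪f s, deriv g s⟫ + ⟪deriv f s, g s⟫)
    (fun s _ => ((hfc.differentiable one_ne_zero s).hasDerivAt).inner ℝ
      ((hgc.differentiable one_ne_zero s).hasDerivAt))
    (Continuous.intervalIntegrable (by fun_prop) _ _)
  rw [intervalIntegral.integral_add (Continuous.intervalIntegrable (by fun_prop) _ _)
    (Continuous.intervalIntegrable (by fun_prop) _ _)] at h
  have hf1 : f 1 = f 0 := by simpa using hf 0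
  have hg1 : g 1 = g 0 := by simpa using hg 0
  rw [hf1, hg1, sub_self] at h
  linarith

/-- The Gateaux derivative of the kinetic energy of a closed curve. -/
theorem hasDerivAt_kinetic (v : ℝ) {y z : ℝ → E} (hper : Function.Periodic y 1)
    (hC2 : ContDiff ℝ 2 y) (hzper : Function.Periodic z 1) (hz : ContDiff ℝ 1 z) :
    HasDerivAt (fun ε : ℝ => ∫ s in (0 : ℝ)..1,
        v ^ 2 / 2 * ‖deriv (fun t => y t + ε • z t) s‖ ^ 2)
      (-∫ s in (0 : ℝ)..1, ⟪v ^ 2 • deriv (deriv y) s, z s⟫) 0 := by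
  have hy1 : ContDiff ℝ 1 (deriv y) := hC2.deriv_one_of_two
  have hy' := hy1.continuous
  have hz' := hz.continuous_deriv le_rfl
  have hexp : ∀ ε : ℝ, ∫ s in (0 : ℝ)..1, v ^ 2 / 2 * ‖deriv (fun t => y t + ε • z t) s‖ ^ 2 =
      (∫ s in (0 : ℝ)..1, v ^ 2 / 2 * ‖deriv y s‖ ^ 2) +
        ε * (v ^ 2 * ∫ s in (0 : ℝ)..1, ⟪deriv y s, deriv z s⟫) +
        ε ^ 2 * ∫ s in (0 : ℝ)..1, v ^ 2 / 2 * ‖deriv z s‖ ^ 2 := by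
    intro ε
    rw [← intervalIntegral.integral_const_mul, ← intervalIntegral.integral_const_mul,
      ← intervalIntegral.integral_const_mul, ← intervalIntegral.integral_add,
      ← intervalIntegral.integral_add]
    · refine intervalIntegral.integral_congr fun s _ => ?_
      have hd : deriv (fun t => y t + ε • z t) s = deriv y s + ε • deriv z s :=
        ((hC2.differentiable two_ne_zero s).hasDerivAt.add
          ((hz.differentiable one_ne_zero s).hasDerivAt.const_smul ε)).deriv
      rw [hd, norm_add_sq_real, real_inner_smul_right, norm_smul, mul_pow, Real.norm_eq_abs,
        sq_abs]
      ring
    all_goals exact Continuous.intervalIntegrable (by fun_prop) _ _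
  simp_rw [hexp]
  have hval : -∫ s in (0 : ℝ)..1, ⟪v ^ 2 • deriv (deriv y) s, z s⟫ =
      v ^ 2 * ∫ s in (0 : ℝ)..1, ⟪deriv y s, deriv z s⟫ := by
    simp_rw [real_inner_smul_left]
    rw [intervalIntegral.integral_const_mul,
      integral_inner_deriv_eq_neg hper.deriv_one hzper hy1 hz]
    ring
  rw [hval]
  have h := (((hasDerivAt_id (0 : ℝ)).mul_const
    (v ^ 2 * ∫ s in (0 : ℝ)..1, ⟪deriv y s, deriv z s⟫)).const_add
    (∫ s in (0 : ℝ)..1, v ^ 2 / 2 * ‖deriv y s‖ ^ 2)).add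
    (((hasDerivAt_id (0 : ℝ)).pow 2).mul_const
      (∫ s in (0 : ℝ)..1, v ^ 2 / 2 * ‖deriv z s‖ ^ 2))
  exact h.congr_deriv (by simp)

end Kinetic

/-- For a 1-periodic C² regular simple closed curve `y`, denoting by `L s`
the principal value `lim_{δ→0⁺} ∫_{s+δ}^{1+s−δ} σ(y(s) − y(r))/‖y(s) − y(r)‖^{2+σ} dr`,
for every 1-periodic C² function `z`, the derivative at `ε = 0` of `ε ↦ 𝒜^σ(y + εz)`
equals `−∫₀¹ [v² ÿ(s) + L s] · z(s) ds`. -/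
theorem gateaux_derivative_action (d : ℕ) (σ v : ℝ) (hσ0 : 0 < σ) (hσ1 : σ < 1)
    (hv : 0 < v)
    (y : ℝ → EuclideanSpace ℝ (Fin d))
    (hper : Function.Periodic y 1)
    (hC2 : ContDiff ℝ 2 y)
    (hreg : ∀ s : ℝ, deriv y s ≠ 0)
    (hinj : Set.InjOn y (Set.Ico (0 : ℝ) 1))
    (L : ℝ → EuclideanSpace ℝ (Fin d))
    (hL : ∀ s : ℝ,
      Tendsto
        (fun δ : ℝ => ∫ r in (s + δ)..(1 + s - δ),
          (σ / ‖y s - y r‖ ^ (2 + σ)) • (y s - y r))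
        (𝓝[>] (0 : ℝ)) (𝓝 (L s)))
    (z : ℝ → EuclideanSpace ℝ (Fin d))
    (hzper : Function.Periodic z 1)
    (hzC2 : ContDiff ℝ 2 z) :
    HasDerivAt (fun ε : ℝ => actionA d σ v (fun t => y t + ε • z t))
      (-∫ s in (0 : ℝ)..1, ⟪v ^ 2 • deriv (deriv y) s + L s, z s⟫) 0 := by
  have hz1 : ContDiff ℝ 1 z := hzC2.of_le one_le_two
  obtain ⟨hLi, hpot⟩ := hasDerivAt_interaction hσ0 hσ1 hper hC2 hreg hinj hL hzper hz1
  have hkin := hasDerivAt_kinetic v hper hC2 hzper hz1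
  have hy2 : Continuous (deriv (deriv y)) :=
    hC2.deriv_one_of_two.continuous_deriv le_rfl
  have hz0 := hzC2.continuous
  have hsum : -∫ s in (0 : ℝ)..1, ⟪v ^ 2 • deriv (deriv y) s + L s, z s⟫ =
      (-∫ s in (0 : ℝ)..1, ⟪v ^ 2 • deriv (deriv y) s, z s⟫) +
        -∫ s in (0 : ℝ)..1, ⟪L s, z s⟫ := by
    simp_rw [inner_add_left]
    rw [intervalIntegral.integral_add (Continuous.intervalIntegrable (by fun_prop) _ _) hLi,
      neg_add]
  rw [hsum]
  exact hkin.add hpot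
end

section
/- Let 0 < σ < 1, c = ∫₀¹ (2 sin(πt))^{−σ} dt, and μ(s) = (2 sin(πs))^{−2−σ}/c for s ∈ (0,1). For a 1-periodic function y : ℝ → ℝ^d whose restriction to [0,1] lies in H¹ and which has zero mean ∫₀¹ y = 0, set ξ_y(t) = ∫₀¹ ‖y(s+t) − y(s)‖² ds. Then ∫₀¹ ‖ẏ(s)‖² ds ≥ 4π² ∫₀¹ μ(t) ξ_y(t) dt. -/
open MeasureTheory Real Filter Topology intervalIntegral

lemma abs_sin_nat_mul_le (n : ℕ) (x : ℝ) : |sin (n * x)| ≤ n * |sin x| := by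
  induction n with
  | zero => simp
  | succ k ih =>
    rw [Nat.cast_succ, add_mul, one_mul, sin_add]
    calc |sin (k * x) * cos x + cos (k * x) * sin x|
        ≤ |sin (k * x)| * |cos x| + |cos (k * x)| * |sin x| := by
          simpa only [abs_mul] using abs_add_le (sin (k * x) * cos x) (cos (k * x) * sin x)
      _ ≤ |sin (k * x)| * 1 + 1 * |sin x| := by
          gcongr
          · exact abs_cos_le_one x
          · exact abs_cos_le_one _
      _ ≤ (k + 1) * |sin x| := by linarith

lemma abs_sin_int_mul_le (n : ℤ) (x : ℝ) : |sin (n * x)| ≤ |(n : ℝ)| * |sin x| := by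
  obtain ⟨m, rfl | rfl⟩ := n.eq_nat_or_neg
  · simpa using abs_sin_nat_mul_le m x
  · simpa using abs_sin_nat_mul_le m x

/-- The kernel `x ↦ exp (-2πi n x)` of the `n`-th Fourier coefficient on `[0, 1]`. -/
noncomputable def fourierKernel (n : ℤ) (x : ℝ) : ℂ :=
  Complex.exp (-(2 * π * n * x : ℝ) * Complex.I)

lemma fourierKernel_eq_mul (n : ℤ) (x r : ℝ) :
    fourierKernel n x = fourierKernel (-n) r * fourierKernel n (x + r) := by
  simp only [fourierKernel, ← Complex.exp_add]
  congr 1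
  push_cast
  ring

lemma norm_fourierKernel (n : ℤ) (x : ℝ) : ‖fourierKernel n x‖ = 1 := by
  rw [fourierKernel, ← Complex.ofReal_neg, Complex.norm_exp_ofReal_mul_I]

lemma continuous_fourierKernel (n : ℤ) : Continuous (fourierKernel n) := by
  unfold fourierKernel
  fun_prop

lemma fourierKernel_periodic (n : ℤ) : Function.Periodic (fourierKernel n) 1 := by
  intro x
  rw [fourierKernel, fourierKernel, Complex.exp_eq_exp_iff_exists_int]
  exact ⟨-n, by push_cast; ring⟩

lemma fourierCoeffOn_zero_one (f : ℝ → ℂ) (n : ℤ) :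
    fourierCoeffOn zero_lt_one f n = ∫ x in (0 : ℝ)..1, fourierKernel n x * f x := by
  rw [fourierCoeffOn_eq_integral]
  simp only [sub_zero, div_one, one_smul, smul_eq_mul]
  refine integral_congr fun x _ => ?_
  simp only [fourier_coe_apply, fourierKernel]
  congr 2
  push_cast
  ring

lemma norm_integral_fourierKernel_le {n : ℤ} (hn : n ≠ 0) (t : ℝ) :
    ‖∫ r in (0 : ℝ)..t, fourierKernel n r‖ ≤ |sin (π * t)| / π := by
  have hn' : (n : ℝ) ≠ 0 := by exact_mod_cast hn
  have hc : (-(2 * π * n : ℝ) * Complex.I : ℂ) ≠ 0 := by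
    rw [← Complex.ofReal_neg]
    exact mul_ne_zero (by exact_mod_cast (neg_ne_zero.2 (by positivity))) Complex.I_ne_zero
  have h1 : ∀ r : ℝ, fourierKernel n r =
      Complex.exp ((-(2 * π * n : ℝ) * Complex.I : ℂ) * r) := fun r => by
    rw [fourierKernel]
    congr 1
    push_cast
    ring
  simp_rw [h1]
  rw [integral_exp_mul_complex hc, norm_div]
  have h2 : (-(2 * π * n : ℝ) * Complex.I : ℂ) * t =
      Complex.I * ((-(2 * π * n * t) : ℝ) : ℂ) := by
    push_cast
    ring
  rw [h2, Complex.ofReal_zero, mul_zero, Complex.exp_zero,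
    Complex.norm_exp_I_mul_ofReal_sub_one, norm_mul, norm_mul, norm_neg, Complex.norm_I,
    mul_one, Complex.norm_real]
  have h3 : -(2 * π * n * t) / 2 = -(n * (π * t)) := by ring
  rw [h3, sin_neg]
  simp only [norm_mul, norm_neg, Real.norm_eq_abs, abs_two, abs_of_pos pi_pos]
  rw [div_le_div_iff₀ (by positivity) pi_pos]
  nlinarith [mul_le_mul_of_nonneg_left (abs_sin_int_mul_le n (π * t)) pi_pos.le]

section Translate

variable {h : ℝ → ℂ}

lemma integrableOn_fourierKernel_mul_translate (hm : Measurable h)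
    (hper : Function.Periodic h 1) (hint : IntervalIntegrable h volume 0 1) (n : ℤ) (t : ℝ) :
    IntegrableOn (Function.uncurry fun s r => fourierKernel n s * h (s + r))
      (Set.uIoc 0 1 ×ˢ Set.uIoc 0 t) := by
  have hI := hper.intervalIntegrable₀ one_ne_zero hint
  have hmeas : Measurable (Function.uncurry fun s r => fourierKernel n s * h (s + r)) :=
    ((continuous_fourierKernel n).measurable.comp measurable_fst).mul
      (hm.comp (measurable_fst.add measurable_snd))
  rw [IntegrableOn, Measure.volume_eq_prod, ← Measure.prod_restrict,
    integrable_prod_iff' hmeas.aestronglyMeasurable]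
  have hnorm : Function.Periodic (fun s => ‖h s‖) 1 := fun s => by simp only [hper s]
  have hconst : ∀ r : ℝ, ∫ s in Set.uIoc (0 : ℝ) 1, ‖fourierKernel n s * h (s + r)‖ =
      ∫ s in (0 : ℝ)..1, ‖h s‖ := fun r => by
    rw [Set.uIoc_of_le zero_le_one, ← integral_of_le zero_le_one]
    simp only [norm_mul, norm_fourierKernel, one_mul]
    rw [integral_comp_add_right (fun s => ‖h s‖) r, zero_add, add_comm 1 r,
      hnorm.intervalIntegral_add_eq r 0, zero_add]
  refine ⟨ae_of_all _ fun r => ?_, ?_⟩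
  · have : IntervalIntegrable (fun s => h (s + r)) volume 0 1 := by
      simpa using (hI (0 + r) (1 + r)).comp_add_right r
    exact (this.continuousOn_mul (continuous_fourierKernel n).continuousOn).def'
  · simp only [Function.uncurry_apply_pair, hconst]
    exact intervalIntegrable_const.def'

lemma fourierCoeffOn_integral_translate (hm : Measurable h)
    (hper : Function.Periodic h 1) (hint : IntervalIntegrable h volume 0 1) (n : ℤ) (t : ℝ) :
    fourierCoeffOn zero_lt_one (fun s => ∫ r in (0 : ℝ)..t, h (s + r)) n =
      (∫ r in (0 : ℝ)..t, fourierKernel (-n) r) * fourierCoeffOn zero_lt_one h n := by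
  simp only [fourierCoeffOn_zero_one]
  have hker : ∀ s, fourierKernel n s * ∫ r in (0 : ℝ)..t, h (s + r) =
      ∫ r in (0 : ℝ)..t, fourierKernel n s * h (s + r) := fun s =>
    (intervalIntegral.integral_const_mul _ _).symm
  simp only [hker]
  rw [intervalIntegral_intervalIntegral_swap
    (integrableOn_fourierKernel_mul_translate hm hper hint n t),
    ← intervalIntegral.integral_mul_const]
  refine integral_congr fun r _ => ?_
  have hp : Function.Periodic (fun s => fourierKernel n s * h s) 1 :=
    (fourierKernel_periodic n).mul hper
  have hshift : ∀ s, fourierKernel n s * h (s + r) =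
      fourierKernel (-n) r * (fourierKernel n (s + r) * h (s + r)) := fun s => by
    rw [← mul_assoc, ← fourierKernel_eq_mul]
  simp only [hshift]
  rw [intervalIntegral.integral_const_mul,
    integral_comp_add_right (fun s => fourierKernel n s * h s) r, zero_add, add_comm 1 r,
    hp.intervalIntegral_add_eq r 0, zero_add]

lemma continuous_integral_translate (hper : Function.Periodic h 1)
    (hint : IntervalIntegrable h volume 0 1) (t : ℝ) :
    Continuous fun s => ∫ r in (0 : ℝ)..t, h (s + r) := by
  have hI := hper.intervalIntegrable₀ one_ne_zero hint
  have hcont := continuous_primitive hI 0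
  have : (fun s => ∫ r in (0 : ℝ)..t, h (s + r)) =
      fun s => (∫ r in (0 : ℝ)..(s + t), h r) - ∫ r in (0 : ℝ)..s, h r := by
    ext1 s
    rw [integral_comp_add_left, add_zero, integral_interval_sub_left (hI _ _) (hI _ _)]
  rw [this]
  exact (hcont.comp (continuous_id.add continuous_const)).sub hcont

/-- The increment over `t` of a primitive of a zero-mean periodic `h` has `L²` norm at most
`|sin (π t)| / π` times that of `h`. -/
lemma integral_norm_integral_translate_sq_le (hm : Measurable h)
    (hper : Function.Periodic h 1) (hL2 : MemLp h 2 (volume.restrict (Set.Ioc 0 1)))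
    (hmean : ∫ s in (0 : ℝ)..1, h s = 0) (t : ℝ) :
    ∫ s in (0 : ℝ)..1, ‖∫ r in (0 : ℝ)..t, h (s + r)‖ ^ 2 ≤
      (sin (π * t) / π) ^ 2 * ∫ s in (0 : ℝ)..1, ‖h s‖ ^ 2 := by
  have hint : IntervalIntegrable h volume 0 1 :=
    (intervalIntegrable_iff_integrableOn_Ioc_of_le zero_le_one).2 (hL2.integrable one_le_two)
  have hW := continuous_integral_translate hper hint t
  have hWL2 : MemLp (fun s => ∫ r in (0 : ℝ)..t, h (s + r)) 2
      (volume.restrict (Set.Ioc 0 1)) := by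
    rw [memLp_two_iff_integrable_sq_norm hW.aestronglyMeasurable]
    exact ((hW.norm.pow 2).intervalIntegrable 0 1).1
  have h1 := hasSum_sq_fourierCoeffOn zero_lt_one hWL2
  have h2 := (hasSum_sq_fourierCoeffOn zero_lt_one hL2).mul_left ((sin (π * t) / π) ^ 2)
  simp only [sub_zero, inv_one, one_smul] at h1 h2
  refine hasSum_le (fun n => ?_) h1 h2
  rw [fourierCoeffOn_integral_translate hm hper hint, norm_mul, mul_pow]
  rcases eq_or_ne n 0 with rfl | hn
  · have : fourierCoeffOn zero_lt_one h 0 = 0 := by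
      rw [fourierCoeffOn_zero_one, ← hmean]
      simp [fourierKernel]
    simp [this]
  · gcongr ?_ * _
    rw [← sq_abs (sin (π * t) / π), abs_div, abs_of_pos pi_pos]
    gcongr
    exact norm_integral_fourierKernel_le (neg_ne_zero.2 hn) t

end Translate

lemma integral_norm_increment_sq_le {ι : Type*} [Fintype ι] {y g : ℝ → EuclideanSpace ℝ ι}
    (hyper : Function.Periodic y 1) (hgper : Function.Periodic g 1) (hgmeas : Measurable g)
    (hgL2 : IntegrableOn (fun s => ‖g s‖ ^ 2) (Set.Icc 0 1))
    (hfund : ∀ t : ℝ, y t = y 0 + ∫ s in (0 : ℝ)..t, g s) (t : ℝ) :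
    ∫ s in (0 : ℝ)..1, ‖y (s + t) - y s‖ ^ 2 ≤
      (sin (π * t) / π) ^ 2 * ∫ s in (0 : ℝ)..1, ‖g s‖ ^ 2 := by
  have hgM : MemLp g 2 (volume.restrict (Set.Ioc 0 1)) :=
    (memLp_two_iff_integrable_sq_norm hgmeas.aestronglyMeasurable).2
      (hgL2.mono_set Set.Ioc_subset_Icc_self)
  have hint : IntervalIntegrable g volume 0 1 :=
    (intervalIntegrable_iff_integrableOn_Ioc_of_le zero_le_one).2 (hgM.integrable one_le_two)
  have hI := hgper.intervalIntegrable₀ one_ne_zero hint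
  have hgmean : ∫ s in (0 : ℝ)..1, g s = 0 := by
    have h1 := hfund 1
    have h0 := hyper 0
    rw [zero_add] at h0
    rw [h0] at h1
    simpa using h1
  have hdiff : ∀ s, y (s + t) - y s = ∫ r in (0 : ℝ)..t, g (s + r) := fun s => by
    rw [hfund (s + t), hfund s, add_sub_add_left_eq_sub, integral_comp_add_left, add_zero,
      integral_interval_sub_left (hI _ _) (hI _ _)]
  let L : ι → EuclideanSpace ℝ ι →L[ℝ] ℂ := fun i =>
    Complex.ofRealCLM.comp (EuclideanSpace.proj i)
  have hsq : ∀ v : EuclideanSpace ℝ ι, ‖v‖ ^ 2 = ∑ i, ‖L i v‖ ^ 2 := fun v => by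
    rw [EuclideanSpace.norm_sq_eq]
    simp [L]
  have hLint : ∀ i (a b s : ℝ), ∫ r in a..b, L i (g (s + r)) = L i (∫ r in a..b, g (s + r)) := by
    intro i a b s
    refine (L i).intervalIntegral_comp_comm ?_
    simpa using (hI (s + a) (s + b)).comp_add_left s
  have hLper : ∀ i, Function.Periodic (fun s => L i (g s)) 1 := fun i s => by simp only [hgper s]
  have hLL2 : ∀ i, MemLp (fun s => L i (g s)) 2 (volume.restrict (Set.Ioc 0 1)) := fun i =>
    (L i).comp_memLp' hgM
  have hLI : ∀ i, IntervalIntegrable (fun s => L i (g s)) volume 0 1 := fun i =>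
    (intervalIntegrable_iff_integrableOn_Ioc_of_le zero_le_one).2 ((hLL2 i).integrable one_le_two)
  simp only [hsq, hdiff, ← hLint]
  rw [intervalIntegral.integral_finsetSum, intervalIntegral.integral_finsetSum, Finset.mul_sum]
  · refine Finset.sum_le_sum fun i _ => ?_
    refine integral_norm_integral_translate_sq_le ((L i).continuous.measurable.comp hgmeas)
      (hLper i) (hLL2 i) ?_ t
    simpa [hgmean] using hLint i 0 1 0
  · intro i _
    rw [intervalIntegrable_iff_integrableOn_Ioc_of_le zero_le_one]
    exact (memLp_two_iff_integrable_sq_norm (hLL2 i).1).1 (hLL2 i)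
  · intro i _
    exact ((continuous_integral_translate (hLper i) (hLI i) t).norm.pow 2).intervalIntegrable 0 1

/-- Let `0 < σ < 1`, `c = ∫₀¹ (2 sin(πt))^{−σ} dt`,
`μ(s) = (2 sin(πs))^{−2−σ}/c`. For a 1-periodic zero-mean `H¹` function
`y : ℝ → ℝ^d` (represented by `y(t) = y(0) + ∫₀ᵗ g` with `g` its 1-periodic weak
derivative, square-integrable on `[0,1]`), with `ξ_y(t) = ∫₀¹ ‖y(s+t) − y(s)‖² ds`,
one has `∫₀¹ ‖ẏ‖² ≥ 4π² ∫₀¹ μ ξ_y`. -/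
theorem kinetic_estimate (d : ℕ) (hd : 2 ≤ d) (σ : ℝ) (hσ0 : 0 < σ) (hσ1 : σ < 1)
    (c : ℝ) (hc : c = ∫ t in (0 : ℝ)..1, (2 * Real.sin (π * t)) ^ (-σ))
    (μ : ℝ → ℝ)
    (hμ : ∀ s ∈ Set.Ioo (0 : ℝ) 1, μ s = (2 * Real.sin (π * s)) ^ (-(2 + σ)) / c)
    (y g : ℝ → EuclideanSpace ℝ (Fin d))
    (hyper : Function.Periodic y 1)
    (hgper : Function.Periodic g 1)
    (hgmeas : Measurable g)
    (hgL2 : IntegrableOn (fun s => ‖g s‖ ^ 2) (Set.Icc 0 1))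
    (hfund : ∀ t : ℝ, y t = y 0 + ∫ s in (0 : ℝ)..t, g s)
    (hmean : (∫ s in (0 : ℝ)..1, y s) = 0) :
    4 * π ^ 2 * ∫ t in (0 : ℝ)..1, μ t * ∫ s in (0 : ℝ)..1, ‖y (s + t) - y s‖ ^ 2 ≤
      ∫ s in (0 : ℝ)..1, ‖g s‖ ^ 2 := by
  have hsin : ∀ t ∈ Set.Ioo (0 : ℝ) 1, 0 < sin (π * t) := fun t ht =>
    sin_pos_of_pos_of_lt_pi (mul_pos pi_pos ht.1) (by nlinarith [pi_pos, ht.2])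
  have hIoo : ∀ᵐ t ∂volume.restrict (Set.Ioc (0 : ℝ) 1), t ∈ Set.Ioo (0 : ℝ) 1 := by
    rw [← restrict_Ioo_eq_restrict_Ioc]
    exact ae_restrict_mem measurableSet_Ioo
  have hc0 : 0 ≤ c := by
    rw [hc, integral_of_le zero_le_one]
    refine integral_nonneg_of_ae ?_
    filter_upwards [hIoo] with t ht
    have := hsin t ht
    simp only [Pi.zero_apply]
    positivity
  set ξ : ℝ → ℝ := fun t => ∫ s in (0 : ℝ)..1, ‖y (s + t) - y s‖ ^ 2
  set G := ∫ s in (0 : ℝ)..1, ‖g s‖ ^ 2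
  have hG0 : 0 ≤ G := integral_nonneg zero_le_one fun s _ => by positivity
  have hξ0 : ∀ t, 0 ≤ ξ t := fun t => integral_nonneg zero_le_one fun s _ => by positivity
  change 4 * π ^ 2 * ∫ t in (0 : ℝ)..1, μ t * ξ t ≤ G
  rcases hc0.eq_or_lt with hc0 | hc0
  · have : ∫ t in (0 : ℝ)..1, μ t * ξ t = 0 := by
      rw [integral_of_le zero_le_one]
      refine integral_eq_zero_of_ae ?_
      filter_upwards [hIoo] with t ht
      simp [hμ t ht, ← hc0]
    simpa [this] using hG0
  have hint : IntervalIntegrable (fun t => (2 * sin (π * t)) ^ (-σ)) volume 0 1 := by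
    by_contra hn
    exact hc0.ne' (hc.trans (integral_undef hn))
  have hle : ∫ t in (0 : ℝ)..1, μ t * ξ t ≤
      ∫ t in (0 : ℝ)..1, (2 * sin (π * t)) ^ (-σ) * (G / (4 * π ^ 2 * c)) := by
    rw [integral_of_le zero_le_one, integral_of_le zero_le_one]
    refine integral_mono_of_nonneg ?_ (hint.mul_const _).1 ?_
    · filter_upwards [hIoo] with t ht
      have := hsin t ht
      rw [hμ t ht]
      exact mul_nonneg (by positivity) (hξ0 t)
    · filter_upwards [hIoo] with t ht
      have hs := hsin t ht
      have hs2 : 0 < 2 * sin (π * t) := by positivity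
      have hpow : (2 * sin (π * t)) ^ (-(2 + σ)) =
          (2 * sin (π * t)) ^ (-σ) / (2 * sin (π * t)) ^ 2 := by
        rw [← rpow_natCast, ← rpow_sub hs2]
        congr 1
        push_cast
        ring
      have hinc : ξ t ≤ (sin (π * t) / π) ^ 2 * G :=
        integral_norm_increment_sq_le hyper hgper hgmeas hgL2 hfund t
      rw [hμ t ht]
      calc (2 * sin (π * t)) ^ (-(2 + σ)) / c * ξ t
          ≤ (2 * sin (π * t)) ^ (-(2 + σ)) / c * ((sin (π * t) / π) ^ 2 * G) := by gcongr
        _ = (2 * sin (π * t)) ^ (-σ) * (G / (4 * π ^ 2 * c)) := by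
          rw [hpow]
          field_simp
          ring
  rw [intervalIntegral.integral_mul_const, ← hc] at hle
  calc 4 * π ^ 2 * ∫ t in (0 : ℝ)..1, μ t * ξ t
      ≤ 4 * π ^ 2 * (c * (G / (4 * π ^ 2 * c))) := by gcongr
    _ = G := by field_simp
end

section
/- Let 0 < σ < 1, c = ∫₀¹ (2 sin(πt))^{−σ} dt, and μ(s) = (2 sin(πs))^{−2−σ}/c for s ∈ (0,1). For a 1-periodic zero-mean H¹ function y : ℝ → ℝ^d, set ξ_y(t) = ∫₀¹ ‖y(s+t) − y(s)‖² ds. Then equality ∫₀¹ ‖ẏ‖² = 4π² ∫₀¹ μ ξ_y holds if and only if there exists a ∈ ℂ^d (identifying y with a ℂ^d-valued Fourier expansion) such that y(t) = a e^{2πit} + ā e^{−2πit} for all t; equivalently, y(t) = E₁ cos(2πt) + E₂ sin(2πt) for some vectors E₁, E₂ ∈ ℝ^d. -/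
open MeasureTheory Real Filter Topology intervalIntegral

/-- Parseval's identity for a real-valued function, in terms of cosine and sine coefficients. -/
lemma hasSum_sq_cos_sin_coeff {u : ℝ → ℝ} (hu : MemLp u 2 (volume.restrict (Set.Ioc 0 1))) :
    HasSum (fun n : ℤ => (∫ s in (0 : ℝ)..1, cos (2 * π * n * s) * u s) ^ 2 +
      (∫ s in (0 : ℝ)..1, sin (2 * π * n * s) * u s) ^ 2) (∫ s in (0 : ℝ)..1, u s ^ 2) := by
  have hui : IntervalIntegrable u volume 0 1 := by
    rw [intervalIntegrable_iff_integrableOn_Ioc_of_le zero_le_one]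
    exact hu.integrable one_le_two
  have key := hasSum_sq_fourierCoeffOn (f := fun s => (u s : ℂ)) zero_lt_one hu.ofReal
  convert key using 2 with n
  · have hc : IntervalIntegrable (fun s => cos (2 * π * n * s) * u s) volume 0 1 :=
      hui.continuousOn_mul (by fun_prop)
    have hs : IntervalIntegrable (fun s => sin (2 * π * n * s) * u s) volume 0 1 :=
      hui.continuousOn_mul (by fun_prop)
    have : fourierCoeffOn zero_lt_one (fun s => (u s : ℂ)) n =
        (∫ s in (0 : ℝ)..1, cos (2 * π * n * s) * u s : ℝ) -
          (∫ s in (0 : ℝ)..1, sin (2 * π * n * s) * u s : ℝ) * Complex.I := by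
      rw [fourierCoeffOn_eq_integral, ← intervalIntegral.integral_ofReal,
        ← intervalIntegral.integral_ofReal, ← intervalIntegral.integral_mul_const,
        ← intervalIntegral.integral_sub]
      · simp only [sub_zero, div_one, one_smul]
        refine intervalIntegral.integral_congr fun s _ => ?_
        simp only [fourier_coe_apply, smul_eq_mul]
        have : 2 * π * Complex.I * ((-n : ℤ) : ℂ) * s / ((1 - 0 : ℝ) : ℂ) =
            (-(2 * π * n * s) : ℂ) * Complex.I := by
          push_cast; ring
        rw [this, Complex.exp_mul_I, Complex.cos_neg, Complex.sin_neg]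
        push_cast
        ring
      · exact ⟨hc.1.ofReal, hc.2.ofReal⟩
      · exact IntervalIntegrable.mul_const ⟨hs.1.ofReal, hs.2.ofReal⟩ _
    rw [this, ← Complex.normSq_eq_norm_sq, Complex.normSq_apply]
    simp
    ring
  · simp

/-- Integration by parts of a primitive against a continuously differentiable function. -/
lemma integral_mul_of_primitive {u w φ φ' : ℝ → ℝ} (hw : IntervalIntegrable w volume 0 1)
    (hu : ∀ t, u t = u 0 + ∫ s in (0 : ℝ)..t, w s)
    (hφ : ∀ t, HasDerivAt φ (φ' t) t) (hφ' : Continuous φ') :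
    ∫ s in (0 : ℝ)..1, φ s * w s =
      φ 1 * u 1 - φ 0 * u 0 - ∫ s in (0 : ℝ)..1, φ' s * u s := by
  have hd : deriv φ = φ' := funext fun t => (hφ t).deriv
  have hφC : ContDiff ℝ 1 φ :=
    contDiff_one_iff_deriv.2 ⟨fun t => (hφ t).differentiableAt, hd ▸ hφ'⟩
  have hφa : AbsolutelyContinuousOnInterval φ 0 1 :=
    hφC.contDiffOn.absolutelyContinuousOnInterval
  have hua : AbsolutelyContinuousOnInterval u 0 1 := by
    have hc : AbsolutelyContinuousOnInterval (fun _ : ℝ => u 0) 0 1 :=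
      (contDiff_const : ContDiff ℝ 1 _).contDiffOn.absolutelyContinuousOnInterval
    have := hc.add (hw.absolutelyContinuousOnInterval_intervalIntegral (c := 0) (by simp))
    exact (funext hu : u = _) ▸ this
  have := hφa.integral_mul_deriv_eq_deriv_mul hua
  rw [hd] at this
  rw [← this]
  refine intervalIntegral.integral_congr_ae ?_
  filter_upwards [hw.ae_hasDerivAt_integral] with x hx hx'
  have h := (hx (Set.uIoc_subset_uIcc hx') 0 (by simp)).const_add (u 0)
  rw [← (funext hu : u = _)] at h
  rw [h.deriv]

lemma cos_coeff_of_primitive {u w : ℝ → ℝ} (hw : IntervalIntegrable w volume 0 1)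
    (hu : ∀ t, u t = u 0 + ∫ s in (0 : ℝ)..t, w s) (hper : u 1 = u 0) (n : ℤ) :
    ∫ s in (0 : ℝ)..1, cos (2 * π * n * s) * w s =
      2 * π * n * ∫ s in (0 : ℝ)..1, sin (2 * π * n * s) * u s := by
  rw [integral_mul_of_primitive (φ' := fun s => -sin (2 * π * n * s) * (2 * π * n)) hw hu
    (fun t => by simpa using ((hasDerivAt_id t).const_mul (2 * π * n)).cos) (by fun_prop),
    ← intervalIntegral.integral_const_mul, hper]
  have : cos (2 * π * n * 1) = 1 := by
    rw [mul_one, mul_comm]; exact cos_int_mul_two_pi n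
  rw [this, mul_zero, cos_zero, sub_self, zero_sub, ← intervalIntegral.integral_neg]
  exact intervalIntegral.integral_congr fun s _ => by ring

lemma sin_coeff_of_primitive {u w : ℝ → ℝ} (hw : IntervalIntegrable w volume 0 1)
    (hu : ∀ t, u t = u 0 + ∫ s in (0 : ℝ)..t, w s) (n : ℤ) :
    ∫ s in (0 : ℝ)..1, sin (2 * π * n * s) * w s =
      -(2 * π * n * ∫ s in (0 : ℝ)..1, cos (2 * π * n * s) * u s) := by
  rw [integral_mul_of_primitive (φ' := fun s => cos (2 * π * n * s) * (2 * π * n)) hw hu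
    (fun t => by simpa using ((hasDerivAt_id t).const_mul (2 * π * n)).sin) (by fun_prop),
    ← intervalIntegral.integral_const_mul]
  have : sin (2 * π * n * 1) = 0 := by
    rw [mul_one, show 2 * π * n = (2 * n : ℤ) * π by push_cast; ring]
    exact sin_int_mul_pi _
  rw [this, mul_zero, sin_zero, zero_mul, zero_mul, sub_self, zero_sub]
  exact congrArg _ (intervalIntegral.integral_congr fun s _ => by ring)

/-- The squared modulus of the `n`-th Fourier coefficient of `u`. -/
noncomputable def fourierPower (u : ℝ → ℝ) (n : ℤ) : ℝ :=
  (∫ s in (0 : ℝ)..1, cos (2 * π * n * s) * u s) ^ 2 +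
    (∫ s in (0 : ℝ)..1, sin (2 * π * n * s) * u s) ^ 2

lemma fourierPower_nonneg (u : ℝ → ℝ) (n : ℤ) : 0 ≤ fourierPower u n := by
  unfold fourierPower; positivity

lemma hasSum_fourierPower_of_primitive {u w : ℝ → ℝ}
    (hw : MemLp w 2 (volume.restrict (Set.Ioc 0 1)))
    (hu : ∀ t, u t = u 0 + ∫ s in (0 : ℝ)..t, w s) (hper : u 1 = u 0) :
    HasSum (fun n : ℤ => 4 * π ^ 2 * n ^ 2 * fourierPower u n)
      (∫ s in (0 : ℝ)..1, w s ^ 2) := by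
  have hwi : IntervalIntegrable w volume 0 1 := by
    rw [intervalIntegrable_iff_integrableOn_Ioc_of_le zero_le_one]
    exact hw.integrable one_le_two
  convert hasSum_sq_cos_sin_coeff hw using 2 with n
  rw [cos_coeff_of_primitive hwi hu hper, sin_coeff_of_primitive hwi hu, fourierPower]
  ring

lemma memLp_two_of_continuous {u : ℝ → ℝ} (hu : Continuous u) :
    MemLp u 2 (volume.restrict (Set.Ioc 0 1)) := by
  rw [memLp_two_iff_integrable_sq hu.aestronglyMeasurable]
  exact (hu.pow 2).integrableOn_Ioc

lemma hasSum_fourierPower_increment {u : ℝ → ℝ} (hu : Continuous u)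
    (hper : Function.Periodic u 1) (t : ℝ) :
    HasSum (fun n : ℤ => 4 * sin (n * (π * t)) ^ 2 * fourierPower u n)
      (∫ s in (0 : ℝ)..1, (u (s + t) - u s) ^ 2) := by
  have hv : Continuous fun s => u (s + t) - u s := by fun_prop
  convert hasSum_sq_cos_sin_coeff (memLp_two_of_continuous hv) using 2 with n
  set θ := 2 * π * n * t with hθ
  have hshift : ∀ f : ℝ → ℝ, Function.Periodic f 1 →
      ∫ s in (0 : ℝ)..1, f (s + t) = ∫ s in (0 : ℝ)..1, f s := fun f hf => by
    rw [intervalIntegral.integral_comp_add_right, zero_add, add_comm 1 t,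
      hf.intervalIntegral_add_eq t 0, zero_add]
  have hper2 : ∀ s, 2 * π * n * (s + 1) - θ = (2 * π * n * s - θ) + n * (2 * π) :=
    fun s => by ring
  have hcs := hshift (fun s => cos (2 * π * n * s - θ) * u s) fun s => by
    simp only [hper2, cos_add_int_mul_two_pi, hper s]
  have hsn := hshift (fun s => sin (2 * π * n * s - θ) * u s) fun s => by
    simp only [hper2, sin_add_int_mul_two_pi, hper s]
  have hsub : ∀ s, 2 * π * n * (s + t) - θ = 2 * π * n * s := fun s => by rw [hθ]; ring
  simp only [hsub, cos_sub, sin_sub] at hcs hsn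
  have hI : ∀ f : ℝ → ℝ, Continuous f → IntervalIntegrable f volume 0 1 :=
    fun f hf => hf.intervalIntegrable _ _
  simp only [mul_sub]
  rw [intervalIntegral.integral_sub (hI _ (by fun_prop)) (hI _ (by fun_prop)),
    intervalIntegral.integral_sub (hI _ (by fun_prop)) (hI _ (by fun_prop)), hcs, hsn]
  have e1 : ∫ s in (0 : ℝ)..1, (cos (2 * π * n * s) * cos θ + sin (2 * π * n * s) * sin θ) * u s =
      cos θ * (∫ s in (0 : ℝ)..1, cos (2 * π * n * s) * u s) +
        sin θ * ∫ s in (0 : ℝ)..1, sin (2 * π * n * s) * u s := by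
    rw [← intervalIntegral.integral_const_mul, ← intervalIntegral.integral_const_mul,
      ← intervalIntegral.integral_add (hI _ (by fun_prop)) (hI _ (by fun_prop))]
    exact intervalIntegral.integral_congr fun s _ => by ring
  have e2 : ∫ s in (0 : ℝ)..1, (sin (2 * π * n * s) * cos θ - cos (2 * π * n * s) * sin θ) * u s =
      cos θ * (∫ s in (0 : ℝ)..1, sin (2 * π * n * s) * u s) -
        sin θ * ∫ s in (0 : ℝ)..1, cos (2 * π * n * s) * u s := by
    rw [← intervalIntegral.integral_const_mul, ← intervalIntegral.integral_const_mul,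
      ← intervalIntegral.integral_sub (hI _ (by fun_prop)) (hI _ (by fun_prop))]
    exact intervalIntegral.integral_congr fun s _ => by ring
  rw [e1, e2, fourierPower]
  have h2 : 4 * sin (n * (π * t)) ^ 2 = 2 - 2 * cos θ := by
    rw [show θ = 2 * (n * (π * t)) by rw [hθ]; ring, cos_two_mul, sin_sq]; ring
  rw [h2]
  have h1 := sin_sq_add_cos_sq θ
  set A := ∫ s in (0 : ℝ)..1, cos (2 * π * n * s) * u s
  set B := ∫ s in (0 : ℝ)..1, sin (2 * π * n * s) * u s
  linear_combination (-(A ^ 2 + B ^ 2)) * h1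

lemma abs_sin_nat_mul_lt {n : ℕ} (hn : 2 ≤ n) {x : ℝ} (hx : sin x ≠ 0) :
    |sin (n * x)| < n * |sin x| := by
  have hpos : 0 < |sin x| := abs_pos.2 hx
  have hcos : |cos x| < 1 := by
    rw [← sq_lt_one_iff_abs_lt_one, cos_sq']
    linarith [pow_pos hpos 2, sq_abs (sin x)]
  obtain ⟨k, rfl⟩ : ∃ k, n = k + 1 := ⟨n - 1, by omega⟩
  have hk : (1 : ℝ) ≤ k := by exact_mod_cast (by omega : 1 ≤ k)
  have h : sin ((k + 1 : ℕ) * x) = sin (k * x) * cos x + cos (k * x) * sin x := by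
    rw [← sin_add]; push_cast; ring_nf
  have h1 : |sin (k * x) * cos x| < k * |sin x| := by
    rw [abs_mul]
    calc |sin (k * x)| * |cos x| ≤ k * |sin x| * |cos x| := by
          gcongr; exact abs_sin_nat_mul_le k x
      _ < k * |sin x| := mul_lt_of_lt_one_right (by positivity) hcos
  have h2 : |cos (k * x) * sin x| ≤ |sin x| := by
    rw [abs_mul]; exact mul_le_of_le_one_left (abs_nonneg _) (abs_cos_le_one _)
  rw [h]
  push_cast
  linarith [abs_add_le (sin (k * x) * cos x) (cos (k * x) * sin x)]

lemma abs_sin_int_mul (n : ℤ) (x : ℝ) : |sin (n * x)| = |sin (n.natAbs * x)| := by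
  obtain h | h := Int.natAbs_eq n <;> rw [h] <;> simp

lemma sin_int_mul_sq_le (n : ℤ) (x : ℝ) : sin (n * x) ^ 2 ≤ n ^ 2 * sin x ^ 2 := by
  rw [← sq_abs, abs_sin_int_mul, ← sq_abs (sin x), ← sq_abs (n : ℝ), ← mul_pow,
    ← Int.cast_abs, ← Nat.cast_natAbs]
  gcongr
  exact abs_sin_nat_mul_le _ _

lemma sin_int_mul_sq_lt {n : ℤ} (hn : 2 ≤ n.natAbs) {x : ℝ} (hx : sin x ≠ 0) :
    sin (n * x) ^ 2 < n ^ 2 * sin x ^ 2 := by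
  rw [← sq_abs, abs_sin_int_mul, ← sq_abs (sin x), ← sq_abs (n : ℝ), ← mul_pow,
    ← Int.cast_abs, ← Nat.cast_natAbs]
  gcongr
  exact abs_sin_nat_mul_lt hn hx

lemma hasSum_increment_defect {u w : ℝ → ℝ}
    (hw : MemLp w 2 (volume.restrict (Set.Ioc 0 1)))
    (hu : ∀ t, u t = u 0 + ∫ s in (0 : ℝ)..t, w s) (hper : Function.Periodic u 1)
    (hc : Continuous u) (t : ℝ) :
    HasSum (fun n : ℤ => 4 * π ^ 2 * (n ^ 2 * sin (π * t) ^ 2 - sin (n * (π * t)) ^ 2) *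
      fourierPower u n)
      (sin (π * t) ^ 2 * (∫ s in (0 : ℝ)..1, w s ^ 2) -
        π ^ 2 * ∫ s in (0 : ℝ)..1, (u (s + t) - u s) ^ 2) := by
  have hper1 : u 1 = u 0 := by simpa using hper 0
  convert! ((hasSum_fourierPower_of_primitive hw hu hper1).mul_left (sin (π * t) ^ 2)).sub
    ((hasSum_fourierPower_increment hc hper t).mul_left (π ^ 2)) using 2
  ring

lemma increment_le {u w : ℝ → ℝ}
    (hw : MemLp w 2 (volume.restrict (Set.Ioc 0 1)))
    (hu : ∀ t, u t = u 0 + ∫ s in (0 : ℝ)..t, w s) (hper : Function.Periodic u 1)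
    (hc : Continuous u) (t : ℝ) :
    π ^ 2 * (∫ s in (0 : ℝ)..1, (u (s + t) - u s) ^ 2) ≤
      sin (π * t) ^ 2 * ∫ s in (0 : ℝ)..1, w s ^ 2 := by
  refine sub_nonneg.1 ((hasSum_increment_defect hw hu hper hc t).nonneg fun n => ?_)
  have := sub_nonneg.2 (sin_int_mul_sq_le n (π * t))
  have := fourierPower_nonneg u n
  positivity

lemma increment_eq_iff {u w : ℝ → ℝ}
    (hw : MemLp w 2 (volume.restrict (Set.Ioc 0 1)))
    (hu : ∀ t, u t = u 0 + ∫ s in (0 : ℝ)..t, w s) (hper : Function.Periodic u 1)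
    (hc : Continuous u) {t : ℝ} (ht : sin (π * t) ≠ 0) :
    π ^ 2 * (∫ s in (0 : ℝ)..1, (u (s + t) - u s) ^ 2) =
      sin (π * t) ^ 2 * (∫ s in (0 : ℝ)..1, w s ^ 2) ↔
    ∀ n : ℤ, 2 ≤ n.natAbs → fourierPower u n = 0 := by
  have hs := hasSum_increment_defect hw hu hper hc t
  have h0 : ∀ n : ℤ, 0 ≤ 4 * π ^ 2 * (n ^ 2 * sin (π * t) ^ 2 - sin (n * (π * t)) ^ 2) *
      fourierPower u n := fun n => by
    have := sub_nonneg.2 (sin_int_mul_sq_le n (π * t))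
    have := fourierPower_nonneg u n
    positivity
  rw [eq_comm, ← sub_eq_zero]
  constructor
  · intro h n hn
    rw [h, hasSum_zero_iff_of_nonneg h0] at hs
    have hpos := sub_pos.2 (sin_int_mul_sq_lt hn ht)
    have := congrFun hs n
    simpa [pi_ne_zero, hpos.ne'] using this
  · intro h
    refine hs.unique ?_
    convert (hasSum_zero : HasSum (fun _ : ℤ => (0 : ℝ)) 0) using 2 with n
    by_cases hn : 2 ≤ n.natAbs
    · rw [h n hn, mul_zero]
    · obtain rfl | rfl | rfl : n = 0 ∨ n = 1 ∨ n = -1 := by omega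
      all_goals simp

lemma integral_cos_two_pi_sq : ∫ s in (0 : ℝ)..1, cos (2 * π * s) ^ 2 = 1 / 2 := by
  rw [intervalIntegral.integral_comp_mul_left (fun x => cos x ^ 2) (by positivity), integral_cos_sq]
  simp
  field_simp

lemma integral_sin_two_pi_sq : ∫ s in (0 : ℝ)..1, sin (2 * π * s) ^ 2 = 1 / 2 := by
  rw [intervalIntegral.integral_comp_mul_left (fun x => sin x ^ 2) (by positivity), integral_sin_sq]
  simp
  field_simp

lemma integral_sin_two_pi_mul_cos : ∫ s in (0 : ℝ)..1, sin (2 * π * s) * cos (2 * π * s) = 0 := by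
  rw [intervalIntegral.integral_comp_mul_left (fun x => sin x * cos x) (by positivity),
    integral_sin_mul_cos₁]
  simp

lemma fourierPower_trig (a b : ℝ) {n : ℤ} (hn : 2 ≤ n.natAbs) :
    fourierPower (fun t => a * cos (2 * π * t) + b * sin (2 * π * t)) n = 0 := by
  set u : ℝ → ℝ := fun t => a * cos (2 * π * t) + b * sin (2 * π * t) with hu
  set v : ℝ → ℝ := fun t => 2 * π * (b * cos (2 * π * t) - a * sin (2 * π * t)) with hv
  have huc : Continuous u := by fun_prop
  have hvc : Continuous v := by fun_prop
  have hlin : ∀ t : ℝ, HasDerivAt (fun t => 2 * π * t) (2 * π) t := fun t => by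
    simpa using (hasDerivAt_id t).const_mul (2 * π)
  have hud : ∀ t, HasDerivAt u (v t) t := fun t => by
    refine HasDerivAt.congr_deriv
      (((hlin t).cos.const_mul a).add ((hlin t).sin.const_mul b)) ?_
    simp only [hv]
    ring
  have hvd : ∀ t, HasDerivAt v (-(4 * π ^ 2) * u t) t := fun t => by
    refine HasDerivAt.congr_deriv
      ((((hlin t).cos.const_mul b).sub ((hlin t).sin.const_mul a)).const_mul (2 * π)) ?_
    simp only [hu]
    ring
  have prim : ∀ f f' : ℝ → ℝ, (∀ t, HasDerivAt f (f' t) t) → Continuous f' →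
      ∀ t, f t = f 0 + ∫ s in (0 : ℝ)..t, f' s := fun f f' hd hc t => by
    rw [intervalIntegral.integral_eq_sub_of_hasDerivAt (fun x _ => hd x)
      (hc.intervalIntegrable _ _)]; ring
  have hu1 : u 1 = u 0 := by simp [hu]
  have hv1 : v 1 = v 0 := by simp [hv]
  have hup := prim u v hud hvc
  have hvp := prim v _ hvd (by fun_prop)
  have hvi : IntervalIntegrable v volume 0 1 := hvc.intervalIntegrable _ _
  have hui : IntervalIntegrable (fun t => -(4 * π ^ 2) * u t) volume 0 1 :=
    Continuous.intervalIntegrable (by fun_prop) _ _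
  have c1 := cos_coeff_of_primitive hvi hup hu1 n
  have s1 := sin_coeff_of_primitive hvi hup n
  have c2 := cos_coeff_of_primitive hui hvp hv1 n
  have s2 := sin_coeff_of_primitive hui hvp n
  simp only [mul_left_comm _ (-(4 * π ^ 2)), intervalIntegral.integral_const_mul] at c2 s2
  rw [s1] at c2
  rw [c1] at s2
  have hn2 : (n : ℝ) ^ 2 - 1 ≠ 0 := by
    rw [sub_ne_zero]
    intro h
    have : n ^ 2 = 1 := by exact_mod_cast h
    rcases eq_or_eq_neg_of_sq_eq_sq n 1 (by simpa using this) with h | h <;> simp [h] at hn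
  have hk : 4 * π ^ 2 * ((n : ℝ) ^ 2 - 1) ≠ 0 := mul_ne_zero (by positivity) hn2
  have hA := (mul_eq_zero.1 (show 4 * π ^ 2 * ((n : ℝ) ^ 2 - 1) *
    ∫ s in (0 : ℝ)..1, cos (2 * π * n * s) * u s = 0 by linear_combination c2)).resolve_left hk
  have hB := (mul_eq_zero.1 (show 4 * π ^ 2 * ((n : ℝ) ^ 2 - 1) *
    ∫ s in (0 : ℝ)..1, sin (2 * π * n * s) * u s = 0 by linear_combination s2)).resolve_left hk
  rw [fourierPower, hA, hB]
  simp

lemma exists_trig_of_fourierPower_eq_zero {u : ℝ → ℝ} (hc : Continuous u)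
    (hper : Function.Periodic u 1) (hmean : ∫ s in (0 : ℝ)..1, u s = 0)
    (h : ∀ n : ℤ, 2 ≤ n.natAbs → fourierPower u n = 0) :
    ∃ a b : ℝ, ∀ t, u t = a * cos (2 * π * t) + b * sin (2 * π * t) := by
  set A := ∫ s in (0 : ℝ)..1, cos (2 * π * s) * u s with hA
  set B := ∫ s in (0 : ℝ)..1, sin (2 * π * s) * u s with hB
  have hP0 : fourierPower u 0 = 0 := by simp [fourierPower, hmean]
  have hP1 : fourierPower u 1 = A ^ 2 + B ^ 2 := by simp [fourierPower, hA, hB]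
  have hPm : fourierPower u (-1) = A ^ 2 + B ^ 2 := by simp [fourierPower, hA, hB]
  have hsq : ∫ s in (0 : ℝ)..1, u s ^ 2 = 2 * (A ^ 2 + B ^ 2) := by
    have hs : HasSum (fourierPower u) _ := hasSum_sq_cos_sin_coeff (memLp_two_of_continuous hc)
    rw [hs.unique (hasSum_sum_of_ne_finset_zero (s := {1, -1}) fun n hn => ?_)]
    · rw [Finset.sum_pair (by norm_num), hP1, hPm]; ring
    · by_cases h2 : 2 ≤ n.natAbs
      · exact h n h2
      · obtain rfl : n = 0 := by
          simp only [Finset.mem_insert, Finset.mem_singleton] at hn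
          omega
        exact hP0
  set v : ℝ → ℝ := fun t => u t - (2 * A * cos (2 * π * t) + 2 * B * sin (2 * π * t)) with hv
  have hvc : Continuous v := by fun_prop
  have hI : ∀ f : ℝ → ℝ, Continuous f → IntervalIntegrable f volume 0 1 :=
    fun f hf => hf.intervalIntegrable _ _
  have hvsq : ∫ s in (0 : ℝ)..1, v s ^ 2 = 0 := by
    have e : ∀ s, v s ^ 2 = u s ^ 2 + (-(4 * A)) * (cos (2 * π * s) * u s) +
        (-(4 * B)) * (sin (2 * π * s) * u s) + 4 * A ^ 2 * cos (2 * π * s) ^ 2 +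
        4 * B ^ 2 * sin (2 * π * s) ^ 2 +
        8 * A * B * (sin (2 * π * s) * cos (2 * π * s)) := fun s => by
      simp only [hv]
      ring
    simp only [e]
    repeat rw [intervalIntegral.integral_add (hI _ (by fun_prop)) (hI _ (by fun_prop))]
    simp only [intervalIntegral.integral_const_mul]
    rw [hsq, integral_cos_two_pi_sq, integral_sin_two_pi_sq, integral_sin_two_pi_mul_cos,
      ← hA, ← hB]
    ring
  have hv0 : ∀ t ∈ Set.Icc (0 : ℝ) 1, v t = 0 := by
    intro t ht
    by_contra hne
    have : 0 < ∫ s in (0 : ℝ)..1, v s ^ 2 :=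
      intervalIntegral.integral_pos zero_lt_one (by fun_prop) (fun s _ => sq_nonneg _)
        ⟨t, ht, by positivity⟩
    exact this.ne' hvsq
  have hvper : Function.Periodic v 1 := fun t => by
    simp only [hv, hper t, mul_add, mul_one, cos_add_two_pi, sin_add_two_pi]
  refine ⟨2 * A, 2 * B, fun t => ?_⟩
  obtain ⟨s, hs, hts⟩ := hvper.exists_mem_Ico₀ zero_lt_one t
  have := hts.trans (hv0 s (Set.Ico_subset_Icc_self hs))
  simp only [hv] at this
  linarith

lemma sin_pi_mul_pos {t : ℝ} (ht : t ∈ Set.Ioo (0 : ℝ) 1) : 0 < sin (π * t) :=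
  sin_pos_of_pos_of_lt_pi (mul_pos pi_pos ht.1) (mul_lt_of_lt_one_right pi_pos ht.2)

lemma le_two_mul_sin_pi_mul {t : ℝ} (h0 : 0 ≤ t) (h1 : t ≤ 1 / 2) : t ≤ 2 * sin (π * t) := by
  have := mul_le_sin (x := π * t) (by positivity) (by nlinarith [pi_pos])
  have e : 2 / π * (π * t) = 2 * t := by field_simp
  linarith

lemma integrableOn_two_mul_sin_rpow {σ : ℝ} (hσ0 : 0 < σ) (hσ1 : σ < 1) :
    IntegrableOn (fun t => (2 * sin (π * t)) ^ (-σ)) (Set.Ioo 0 1) := by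
  have h1 : IntervalIntegrable (fun t : ℝ => t ^ (-σ)) volume 0 1 :=
    intervalIntegral.intervalIntegrable_rpow' (by linarith)
  have h2 : IntervalIntegrable (fun t : ℝ => (1 - t) ^ (-σ)) volume 0 1 := by
    simpa using (h1.comp_sub_left 1).symm
  have h3 : IntegrableOn (fun t : ℝ => t ^ (-σ) + (1 - t) ^ (-σ)) (Set.Ioo 0 1) :=
    (intervalIntegrable_iff_integrableOn_Ioo_of_le zero_le_one).1 (h1.add h2)
  refine h3.mono' (Measurable.aestronglyMeasurable (by fun_prop)) ?_
  filter_upwards [ae_restrict_mem measurableSet_Ioo] with t ht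
  have hs := sin_pi_mul_pos ht
  have p1 : 0 ≤ t ^ (-σ) := rpow_nonneg ht.1.le _
  have p2 : 0 ≤ (1 - t) ^ (-σ) := rpow_nonneg (by linarith [ht.2]) _
  rw [norm_of_nonneg (by positivity)]
  rcases le_total t (1 / 2) with h | h
  · have := rpow_le_rpow_of_nonpos ht.1 (le_two_mul_sin_pi_mul ht.1.le h) (neg_nonpos.2 hσ0.le)
    linarith
  · have e : sin (π * (1 - t)) = sin (π * t) := by rw [mul_sub, mul_one, sin_pi_sub]
    have := rpow_le_rpow_of_nonpos (sub_pos.2 ht.2)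
      (le_two_mul_sin_pi_mul (t := 1 - t) (by linarith [ht.2]) (by linarith))
      (neg_nonpos.2 hσ0.le)
    rw [e] at this
    linarith

lemma integral_two_mul_sin_rpow_pos {σ : ℝ} (hσ0 : 0 < σ) (hσ1 : σ < 1) :
    0 < ∫ t in (0 : ℝ)..1, (2 * sin (π * t)) ^ (-σ) := by
  refine intervalIntegral.intervalIntegral_pos_of_pos_on
    ((intervalIntegrable_iff_integrableOn_Ioo_of_le zero_le_one).2
      (integrableOn_two_mul_sin_rpow hσ0 hσ1)) (fun t ht => ?_) zero_lt_one
  have := sin_pi_mul_pos ht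
  positivity

/-- The defect in the weighted inequality, as the integral of a pointwise nonnegative defect. -/
lemma weighted_defect {σ : ℝ} (hσ0 : 0 < σ) (hσ1 : σ < 1) {c : ℝ}
    (hc : c = ∫ t in (0 : ℝ)..1, (2 * sin (π * t)) ^ (-σ)) {μ : ℝ → ℝ}
    (hμ : ∀ s ∈ Set.Ioo (0 : ℝ) 1, μ s = (2 * sin (π * s)) ^ (-(2 + σ)) / c)
    {ξ : ℝ → ℝ} (hξ : Continuous ξ) (hξ0 : ∀ t, 0 ≤ ξ t) {D : ℝ}
    (hle : ∀ t, π ^ 2 * ξ t ≤ sin (π * t) ^ 2 * D) :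
    IntegrableOn (fun t => 4 * μ t * (sin (π * t) ^ 2 * D - π ^ 2 * ξ t)) (Set.Ioo 0 1) ∧
    ∫ t in Set.Ioo 0 1, 4 * μ t * (sin (π * t) ^ 2 * D - π ^ 2 * ξ t) =
      D - 4 * π ^ 2 * ∫ t in (0 : ℝ)..1, μ t * ξ t := by
  have hcpos : 0 < c := hc ▸ integral_two_mul_sin_rpow_pos hσ0 hσ1
  have hK := integrableOn_two_mul_sin_rpow hσ0 hσ1
  have hG := hK.mul_const (D / c)
  have hμK : ∀ t ∈ Set.Ioo (0 : ℝ) 1,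
      4 * μ t * (sin (π * t) ^ 2 * D) = (2 * sin (π * t)) ^ (-σ) * (D / c) := fun t ht => by
    have hs : 0 < 2 * sin (π * t) := by have := sin_pi_mul_pos ht; positivity
    have : (2 * sin (π * t)) ^ (-σ) =
        (2 * sin (π * t)) ^ (-(2 + σ)) * (2 * sin (π * t)) ^ 2 := by
      rw [← rpow_natCast, ← rpow_add hs]; congr 1; push_cast; ring
    rw [hμ t ht, this]
    field_simp
    ring
  have hμ0 : ∀ t ∈ Set.Ioo (0 : ℝ) 1, 0 < μ t := fun t ht => by
    rw [hμ t ht]; have := sin_pi_mul_pos ht; positivity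
  have hG' : IntegrableOn (fun t => 4 * μ t * (sin (π * t) ^ 2 * D)) (Set.Ioo 0 1) :=
    IntegrableOn.congr_fun hG (fun t ht => (hμK t ht).symm) measurableSet_Ioo
  have hμm : AEStronglyMeasurable μ (volume.restrict (Set.Ioo 0 1)) := by
    refine AEStronglyMeasurable.congr
      (f := fun s => (2 * sin (π * s)) ^ (-(2 + σ)) / c)
      (Measurable.aestronglyMeasurable (by fun_prop)) ?_
    filter_upwards [ae_restrict_mem measurableSet_Ioo] with t ht using (hμ t ht).symm
  have hF : IntegrableOn (fun t => 4 * μ t * (π ^ 2 * ξ t)) (Set.Ioo 0 1) := by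
    refine hG'.mono' ((hμm.const_mul 4).mul (by fun_prop)) ?_
    filter_upwards [ae_restrict_mem measurableSet_Ioo] with t ht
    have h0 := hμ0 t ht
    have h1 := hξ0 t
    rw [norm_of_nonneg (by positivity)]
    exact mul_le_mul_of_nonneg_left (hle t) (by positivity)
  simp only [mul_sub]
  refine ⟨hG'.sub hF, ?_⟩
  rw [integral_sub hG' hF, setIntegral_congr_fun measurableSet_Ioo hμK,
    MeasureTheory.integral_mul_const, ← integral_Ioc_eq_integral_Ioo,
    ← integral_Ioc_eq_integral_Ioo,
    ← intervalIntegral.integral_of_le zero_le_one, ← intervalIntegral.integral_of_le zero_le_one,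
    ← hc, mul_div_cancel₀ _ hcpos.ne', ← intervalIntegral.integral_const_mul]
  exact congrArg _ (intervalIntegral.integral_congr fun s _ => by ring)

/-- Equality in the weighted inequality forces pointwise equality somewhere in `(0, 1)`. -/
lemma weighted_eq_imp_exists {σ : ℝ} (hσ0 : 0 < σ) (hσ1 : σ < 1) {c : ℝ}
    (hc : c = ∫ t in (0 : ℝ)..1, (2 * sin (π * t)) ^ (-σ)) {μ : ℝ → ℝ}
    (hμ : ∀ s ∈ Set.Ioo (0 : ℝ) 1, μ s = (2 * sin (π * s)) ^ (-(2 + σ)) / c)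
    {ξ : ℝ → ℝ} (hξ : Continuous ξ) (hξ0 : ∀ t, 0 ≤ ξ t) {D : ℝ}
    (hle : ∀ t, π ^ 2 * ξ t ≤ sin (π * t) ^ 2 * D)
    (h : D = 4 * π ^ 2 * ∫ t in (0 : ℝ)..1, μ t * ξ t) :
    ∃ t ∈ Set.Ioo (0 : ℝ) 1, π ^ 2 * ξ t = sin (π * t) ^ 2 * D := by
  obtain ⟨hint, heq⟩ := weighted_defect hσ0 hσ1 hc hμ hξ hξ0 hle
  have hcpos : 0 < c := hc ▸ integral_two_mul_sin_rpow_pos hσ0 hσ1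
  have hμ0 : ∀ t ∈ Set.Ioo (0 : ℝ) 1, 0 < μ t := fun t ht => by
    rw [hμ t ht]; have := sin_pi_mul_pos ht; positivity
  rw [sub_eq_zero.2 h, integral_eq_zero_iff_of_nonneg_ae _ hint] at heq
  · have hne : (ae (volume.restrict (Set.Ioo (0 : ℝ) 1))).NeBot := by
      rw [ae_neBot]; simp
    obtain ⟨t, h0, ht⟩ := (heq.and (ae_restrict_mem measurableSet_Ioo)).exists
    refine ⟨t, ht, ?_⟩
    have := (mul_eq_zero.1 h0).resolve_left (mul_ne_zero four_ne_zero (hμ0 t ht).ne')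
    linarith
  · filter_upwards [ae_restrict_mem measurableSet_Ioo] with t ht
    exact mul_nonneg (mul_nonneg zero_le_four (hμ0 t ht).le) (sub_nonneg.2 (hle t))

/-- With the notation of the kinetic estimate (`0 < σ < 1`,
`c = ∫₀¹ (2 sin(πt))^{−σ} dt`, `μ(s) = (2 sin(πs))^{−2−σ}/c`,
`ξ_y(t) = ∫₀¹ ‖y(s+t) − y(s)‖² ds`), for a 1-periodic zero-mean `H¹` function `y`
(represented by `y(t) = y(0) + ∫₀ᵗ g`), equality `∫₀¹ ‖ẏ‖² = 4π² ∫₀¹ μ ξ_y` holds if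
and only if `y(t) = E₁ cos(2πt) + E₂ sin(2πt)` for some vectors `E₁, E₂ ∈ ℝ^d`. -/
theorem kinetic_estimate_equality (d : ℕ) (hd : 2 ≤ d) (σ : ℝ) (hσ0 : 0 < σ)
    (hσ1 : σ < 1)
    (c : ℝ) (hc : c = ∫ t in (0 : ℝ)..1, (2 * Real.sin (π * t)) ^ (-σ))
    (μ : ℝ → ℝ)
    (hμ : ∀ s ∈ Set.Ioo (0 : ℝ) 1, μ s = (2 * Real.sin (π * s)) ^ (-(2 + σ)) / c)
    (y g : ℝ → EuclideanSpace ℝ (Fin d))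
    (hyper : Function.Periodic y 1)
    (hgper : Function.Periodic g 1)
    (hgmeas : Measurable g)
    (hgL2 : IntegrableOn (fun s => ‖g s‖ ^ 2) (Set.Icc 0 1))
    (hfund : ∀ t : ℝ, y t = y 0 + ∫ s in (0 : ℝ)..t, g s)
    (hmean : (∫ s in (0 : ℝ)..1, y s) = 0) :
    ((∫ s in (0 : ℝ)..1, ‖g s‖ ^ 2) =
        4 * π ^ 2 * ∫ t in (0 : ℝ)..1, μ t * ∫ s in (0 : ℝ)..1, ‖y (s + t) - y s‖ ^ 2) ↔
      ∃ E₁ E₂ : EuclideanSpace ℝ (Fin d),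
        ∀ t : ℝ, y t = Real.cos (2 * π * t) • E₁ + Real.sin (2 * π * t) • E₂ := by
  have hgLp : MemLp g 2 (volume.restrict (Set.Ioc 0 1)) := by
    rw [memLp_two_iff_integrable_sq_norm hgmeas.aestronglyMeasurable]
    exact hgL2.mono_set Set.Ioc_subset_Icc_self
  have hgi : ∀ a b : ℝ, IntervalIntegrable g volume a b := by
    refine hgper.intervalIntegrable₀ one_ne_zero ?_
    rw [intervalIntegrable_iff_integrableOn_Ioc_of_le zero_le_one]
    exact hgLp.integrable one_le_two
  have hyc : Continuous y := by
    rw [funext hfund]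
    exact continuous_const.add (intervalIntegral.continuous_primitive hgi 0)
  have hwLp : ∀ i, MemLp (fun s => g s i) 2 (volume.restrict (Set.Ioc 0 1)) := fun i =>
    hgLp.mono (by fun_prop) (ae_of_all _ fun s => PiLp.norm_apply_le (g s) i)
  have hyci : ∀ i, Continuous fun s => y s i := fun i => by fun_prop
  have hu : ∀ i t, y t i = y 0 i + ∫ s in (0 : ℝ)..t, g s i := fun i t => by
    have := (EuclideanSpace.proj (𝕜 := ℝ) i).intervalIntegral_comp_comm (hgi 0 t)
    rw [hfund t, PiLp.add_apply]
    exact congrArg _ this.symm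
  have hper : ∀ i, Function.Periodic (fun s => y s i) 1 := fun i t => by simp only [hyper t]
  have hmi : ∀ i, ∫ s in (0 : ℝ)..1, y s i = 0 := fun i => by
    have := (EuclideanSpace.proj (𝕜 := ℝ) i).intervalIntegral_comp_comm
      (hyc.intervalIntegrable (μ := volume) 0 1)
    rw [hmean, map_zero] at this
    exact this
  have hD : ∫ s in (0 : ℝ)..1, ‖g s‖ ^ 2 = ∑ i, ∫ s in (0 : ℝ)..1, g s i ^ 2 := by
    simp only [EuclideanSpace.real_norm_sq_eq]
    refine intervalIntegral.integral_finsetSum fun i _ => ?_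
    rw [intervalIntegrable_iff_integrableOn_Ioc_of_le zero_le_one]
    exact (hwLp i).integrable_sq
  have hξs : ∀ t, ∫ s in (0 : ℝ)..1, ‖y (s + t) - y s‖ ^ 2 =
      ∑ i, ∫ s in (0 : ℝ)..1, (y (s + t) i - y s i) ^ 2 := fun t => by
    simp only [EuclideanSpace.real_norm_sq_eq, PiLp.sub_apply]
    exact intervalIntegral.integral_finsetSum fun i _ =>
      Continuous.intervalIntegrable (by fun_prop) _ _
  have hlei : ∀ i t, π ^ 2 * (∫ s in (0 : ℝ)..1, (y (s + t) i - y s i) ^ 2) ≤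
      sin (π * t) ^ 2 * ∫ s in (0 : ℝ)..1, g s i ^ 2 := fun i t =>
    increment_le (hwLp i) (hu i) (hper i) (hyci i) t
  have hle : ∀ t, π ^ 2 * (∫ s in (0 : ℝ)..1, ‖y (s + t) - y s‖ ^ 2) ≤
      sin (π * t) ^ 2 * ∫ s in (0 : ℝ)..1, ‖g s‖ ^ 2 := fun t => by
    rw [hξs, hD, Finset.mul_sum, Finset.mul_sum]
    exact Finset.sum_le_sum fun i _ => hlei i t
  have hξc : Continuous fun t => ∫ s in (0 : ℝ)..1, ‖y (s + t) - y s‖ ^ 2 :=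
    intervalIntegral.continuous_parametric_intervalIntegral_of_continuous' (by fun_prop) _ _
  have hξ0 : ∀ t, 0 ≤ ∫ s in (0 : ℝ)..1, ‖y (s + t) - y s‖ ^ 2 := fun t =>
    intervalIntegral.integral_nonneg zero_le_one fun s _ => by positivity
  constructor
  · intro h
    obtain ⟨t, ht, hteq⟩ := weighted_eq_imp_exists hσ0 hσ1 hc hμ hξc hξ0 hle h
    rw [hξs, hD, Finset.mul_sum, Finset.mul_sum,
      Finset.sum_eq_sum_iff_of_le fun i _ => hlei i t] at hteq
    have hex : ∀ i, ∃ a b : ℝ, ∀ t, y t i = a * cos (2 * π * t) + b * sin (2 * π * t) := fun i =>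
      exists_trig_of_fourierPower_eq_zero (hyci i) (hper i) (hmi i)
        ((increment_eq_iff (hwLp i) (hu i) (hper i) (hyci i) (sin_pi_mul_pos ht).ne').1
          (hteq i (Finset.mem_univ i)))
    choose a b hab using hex
    refine ⟨WithLp.toLp 2 a, WithLp.toLp 2 b, fun t => ?_⟩
    ext i
    simp [hab i t, mul_comm]
  · rintro ⟨E₁, E₂, hE⟩
    rw [← sub_eq_zero, ← (weighted_defect hσ0 hσ1 hc hμ hξc hξ0 hle).2]
    refine setIntegral_eq_zero_of_forall_eq_zero fun t ht => ?_
    have hi : ∀ i, π ^ 2 * (∫ s in (0 : ℝ)..1, (y (s + t) i - y s i) ^ 2) =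
        sin (π * t) ^ 2 * ∫ s in (0 : ℝ)..1, g s i ^ 2 := fun i => by
      refine (increment_eq_iff (hwLp i) (hu i) (hper i) (hyci i) (sin_pi_mul_pos ht).ne').2
        fun n hn => ?_
      have : (fun s => y s i) = fun s => E₁ i * cos (2 * π * s) + E₂ i * sin (2 * π * s) :=
        funext fun s => by simp [hE s, mul_comm]
      rw [this]
      exact fourierPower_trig _ _ hn
    rw [hξs, hD, Finset.mul_sum, Finset.mul_sum, Finset.sum_congr rfl fun i _ => hi i, sub_self,
      mul_zero]
end
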